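/- Let A ∈ BH_n(F) and π ∈ F^×. The total cohomology H(B^0_A(F)) of the complex B^0_A(F) is isomorphic as an F-vector space to the Milnor ring F[x_1,…,x_n]/(∂_1 W_A, …, ∂_n W_A). -/

import Mathlib

open scoped BigOperators TensorProduct
open Matrix Classical

noncomputable section

/-- The invertible-type polynomial `W_A = ∑ i, ∏ j, x_j ^ A i j`. -/
def Wpoly (F : Type) [Field F] {ι : Type} [Fintype ι] (A : Matrix ι ι ℕ) :
    MvPolynomial ι F :=
  ∑ i, ∏ j, MvPolynomial.X j ^ A i j

/-- `A` is a Berglund–Hübsch matrix over the field `F`. -/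
def IsBH (F : Type) [Field F] {ι : Type} [Fintype ι] [LinearOrder ι]
    (A : Matrix ι ι ℕ) : Prop :=
  (A.map ((↑) : ℕ → ℚ)).det ≠ 0 ∧
  (ringChar F = 0 ∨ ((A.map ((↑) : ℕ → ℤ)).det < (ringChar F : ℤ))) ∧
  (∃ q : ι → ℚ, (∀ j, 0 < q j) ∧ ∀ i, (∑ j, (A i j : ℚ) * q j) = 1) ∧
  RingTheory.Sequence.IsRegular (MvPolynomial ι F)
    ((Finset.univ.sort (· ≤ ·)).map fun i => MvPolynomial.pderiv i (Wpoly F A))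

/-- The model for the exterior algebra `⋀(Fⁿ)`: the free `F`-module on the standard
basis monomials `e_S = e_{s_1} ∧ … ∧ e_{s_k}`, `s_1 < … < s_k`, indexed by finite sets. -/
abbrev ExtV (F : Type) (ι : Type) := Finset ι → F

/-- Exterior multiplication by `e_i` on `⋀(Fⁿ)`. -/
def mulE (F : Type) [Field F] {ι : Type} [LinearOrder ι] (i : ι) :
    ExtV F ι →ₗ[F] ExtV F ι where
  toFun f S := if i ∈ S then (-1 : F) ^ (S.filter (· < i)).card * f (S.erase i) else 0
  map_add' f g := by
    funext S
    by_cases h : i ∈ S <;> simp [h, mul_add]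
  map_smul' a f := by
    funext S
    by_cases h : i ∈ S <;> simp [h, mul_left_comm]

/-- Contraction `e_i^∨` on `⋀(Fⁿ)`. -/
def contrE (F : Type) [Field F] {ι : Type} [LinearOrder ι] (i : ι) :
    ExtV F ι →ₗ[F] ExtV F ι where
  toFun f S := if i ∈ S then 0 else (-1 : F) ^ (S.filter (· < i)).card * f (insert i S)
  map_add' f g := by
    funext S
    by_cases h : i ∈ S <;> simp [h, mul_add]
  map_smul' a f := by
    funext S
    by_cases h : i ∈ S <;> simp [h, mul_left_comm]

/-- `E_{A,i} = π ∑_j A_{ij} e_j`. -/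
def EA (F : Type) [Field F] {ι : Type} [Fintype ι] [LinearOrder ι]
    (π : F) (A : Matrix ι ι ℕ) (i : ι) : ExtV F ι →ₗ[F] ExtV F ι :=
  π • ∑ j, (A i j : F) • mulE F j

/-- `E^∨_{A,i} = π⁻¹ ∑_j (A⁻¹)_{ji} e_j^∨`, the inverse matrix being computed over `F`. -/
def EAdual (F : Type) [Field F] {ι : Type} [Fintype ι] [LinearOrder ι]
    (π : F) (A : Matrix ι ι ℕ) (i : ι) : ExtV F ι →ₗ[F] ExtV F ι :=
  π⁻¹ • ∑ j, ((A.map ((↑) : ℕ → F))⁻¹ j i) • contrE F j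

/-- The element `E_{Aᵀ,1} E_{Aᵀ,2} ⋯ E_{Aᵀ,n} (1) ∈ ⋀(Fⁿ)`. -/
def starTop (F : Type) [Field F] {ι : Type} [Fintype ι] [LinearOrder ι]
    (π : F) (A : Matrix ι ι ℕ) : ExtV F ι :=
  (Finset.univ.sort (· ≤ ·)).foldr (fun i v => EA F π Aᵀ i v)
    (Pi.single (∅ : Finset ι) (1 : F))

/-- Borisov's duality operator `*^A`, defined on the standard basis by
`*^A(e_{i_1} ∧ … ∧ e_{i_k}) = E^∨_{Aᵀ,i_1} ⋯ E^∨_{Aᵀ,i_k}(E_{Aᵀ,1} ⋯ E_{Aᵀ,n}(1))`. -/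
def starA (F : Type) [Field F] {ι : Type} [Fintype ι] [LinearOrder ι]
    (π : F) (A : Matrix ι ι ℕ) : ExtV F ι →ₗ[F] ExtV F ι :=
  (Pi.basisFun F (Finset ι)).constr F fun S =>
    (S.sort (· ≤ ·)).foldr (fun i v => EAdual F π Aᵀ i v) (starTop F π A)

/-- Index of a monomial `x^γ y^λ`. -/
abbrev MonIdx (ι : Type) := (ι → ℕ) × (ι → ℕ)

/-- The matrix `A` viewed over `ℚ`. -/
def Aq {ι : Type} [Fintype ι] [LinearOrder ι] (A : Matrix ι ι ℕ) : Matrix ι ι ℚ :=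
  A.map ((↑) : ℕ → ℚ)

/-- The row vector `λ A⁻ᵀ`, computed over `ℚ`. -/
def lamRow {ι : Type} [Fintype ι] [LinearOrder ι] (A : Matrix ι ι ℕ) (lam : ι → ℕ) :
    ι → ℚ :=
  Matrix.vecMul (fun i => (lam i : ℚ)) ((Aq A)ᵀ)⁻¹

/-- The row vector `γ A⁻¹`, computed over `ℚ`. -/
def gamRow {ι : Type} [Fintype ι] [LinearOrder ι] (A : Matrix ι ι ℕ) (gam : ι → ℕ) :
    ι → ℚ :=
  Matrix.vecMul (fun i => (gam i : ℚ)) (Aq A)⁻¹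

/-- The allowed monomials `x^γ y^λ` of `R_A`: `(λA⁻ᵀ)_i ≥ 0` for all `i`, and
`γ A⁻¹ λᵀ = 0`. -/
def OKA {ι : Type} [Fintype ι] [LinearOrder ι] (A : Matrix ι ι ℕ) (m : MonIdx ι) : Prop :=
  (∀ i, 0 ≤ lamRow A m.2 i) ∧ (gamRow A m.1 ⬝ᵥ fun i => ((m.2 i : ℚ))) = 0

/-- The space `R_A(F)`: the free `F`-module on the allowed monomials `x^γ y^λ`. -/
abbrev RMod (F : Type) [Field F] {ι : Type} [Fintype ι] [LinearOrder ι]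
    (A : Matrix ι ι ℕ) := {m : MonIdx ι // OKA A m} →₀ F

/-- The monomial `x^γ y^λ` as an element of `R_A(F)` (`0` if not allowed). -/
def bE (F : Type) [Field F] {ι : Type} [Fintype ι] [LinearOrder ι]
    (A : Matrix ι ι ℕ) (m : MonIdx ι) : RMod F A :=
  if h : OKA A m then Finsupp.single ⟨m, h⟩ 1 else 0

/-- `θ_{A,i}(x^γ y^λ) = γ_i x^γ y^λ`. -/
def thetaOp (F : Type) [Field F] {ι : Type} [Fintype ι] [LinearOrder ι]
    (A : Matrix ι ι ℕ) (i : ι) : RMod F A →ₗ[F] RMod F A :=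
  Finsupp.linearCombination F fun m => ((m.1.1 i : F)) • Finsupp.single m (1 : F)

/-- `T^∨_{A,i}(x^γ y^λ) = π⁻¹ (λA⁻ᵀ)_i x^γ y^λ`, the matrix inverse being computed
over `F`. -/
def TdualOp (F : Type) [Field F] {ι : Type} [Fintype ι] [LinearOrder ι]
    (π : F) (A : Matrix ι ι ℕ) (i : ι) : RMod F A →ₗ[F] RMod F A :=
  Finsupp.linearCombination F fun m =>
    (π⁻¹ * Matrix.vecMul (fun k => ((m.1.2 k : F))) (((A.map ((↑) : ℕ → F))ᵀ)⁻¹) i) •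
      Finsupp.single m (1 : F)

/-- `ψ^∨_{A,i}(x^γ y^λ) = x^γ y^{λ + e_i Aᵀ}`. -/
def psidualOp (F : Type) [Field F] {ι : Type} [Fintype ι] [LinearOrder ι]
    (A : Matrix ι ι ℕ) (i : ι) : RMod F A →ₗ[F] RMod F A :=
  Finsupp.linearCombination F fun m => bE F A (m.1.1, fun j => m.1.2 j + A j i)

/-- `φ_{A,i}(x^γ y^λ) = π ∑_j A_{ji} x^{γ + e_j A} y^λ`. -/
def phiOp (F : Type) [Field F] {ι : Type} [Fintype ι] [LinearOrder ι]
    (π : F) (A : Matrix ι ι ℕ) (i : ι) : RMod F A →ₗ[F] RMod F A :=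
  Finsupp.linearCombination F fun m =>
    π • ∑ j, (A j i : F) • bE F A ((fun k => m.1.1 k + A j k), m.1.2)

/-- The underlying module of the complex `B_A(F) = R_A(F) ⊗ ⋀(Fⁿ)`. -/
abbrev BMod (F : Type) [Field F] {ι : Type} [Fintype ι] [LinearOrder ι]
    (A : Matrix ι ι ℕ) := TensorProduct F (RMod F A) (ExtV F ι)

/-- `d_{A,i} = (θ_{A,i} + φ_{A,i}) ⊗ e_i`. -/
def dSingle (F : Type) [Field F] {ι : Type} [Fintype ι] [LinearOrder ι]
    (π : F) (A : Matrix ι ι ℕ) (i : ι) : BMod F A →ₗ[F] BMod F A :=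
  TensorProduct.map (thetaOp F A i + phiOp F π A i) (mulE F i)

/-- `d^∨_{A,i} = (T^∨_{A,i} + ψ^∨_{A,i}) ⊗ e_i^∨`. -/
def dDualSingle (F : Type) [Field F] {ι : Type} [Fintype ι] [LinearOrder ι]
    (π : F) (A : Matrix ι ι ℕ) (i : ι) : BMod F A →ₗ[F] BMod F A :=
  TensorProduct.map (TdualOp F π A i + psidualOp F A i) (contrE F i)

/-- `d_A = ∑ i, d_{A,i}`. -/
def dOp (F : Type) [Field F] {ι : Type} [Fintype ι] [LinearOrder ι]
    (π : F) (A : Matrix ι ι ℕ) : BMod F A →ₗ[F] BMod F A :=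
  ∑ i, dSingle F π A i

/-- `d^∨_A = ∑ i, d^∨_{A,i}`. -/
def dDualOp (F : Type) [Field F] {ι : Type} [Fintype ι] [LinearOrder ι]
    (π : F) (A : Matrix ι ι ℕ) : BMod F A →ₗ[F] BMod F A :=
  ∑ i, dDualSingle F π A i

/-- The total differential `d_A + d^∨_A` of the complex `B_A(F)`. -/
def DOp (F : Type) [Field F] {ι : Type} [Fintype ι] [LinearOrder ι]
    (π : F) (A : Matrix ι ι ℕ) : BMod F A →ₗ[F] BMod F A :=
  dOp F π A + dDualOp F π A

end
noncomputable section

/-- The basis element `x^γ y^λ ⊗ e_S` of `B_A(F)`. -/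
def basisTensor (F : Type) [Field F] {ι : Type} [Fintype ι] [LinearOrder ι]
    (A : Matrix ι ι ℕ) (m : {m : MonIdx ι // OKA A m}) (S : Finset ι) : BMod F A :=
  Finsupp.single m (1 : F) ⊗ₜ[F] Pi.single S (1 : F)

/-- The subcomplex `B^λ_A(F) ⊆ B_A(F)` spanned by the monomials `x^γ y^{λ + μAᵀ} ⊗ e_S`. -/
def BlamSub (F : Type) [Field F] {ι : Type} [Fintype ι] [LinearOrder ι]
    (A : Matrix ι ι ℕ) (lam : ι → ℕ) : Submodule F (BMod F A) :=
  Submodule.span F {x | ∃ m S, (∃ μ : ι → ℕ, ∀ j, m.1.2 j = lam j + ∑ k, μ k * A j k) ∧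
    x = basisTensor F A m S}

/-- The subcomplex `B^0_A(F) ⊆ B_A(F)` spanned by the monomials `x^γ y^{μAᵀ} ⊗ e_S`. -/
def B0Sub (F : Type) [Field F] {ι : Type} [Fintype ι] [LinearOrder ι]
    (A : Matrix ι ι ℕ) : Submodule F (BMod F A) :=
  BlamSub F A 0

/-- The subcomplex `C_A(F) ⊆ B_A(F)` spanned by the monomials `x^γ y^λ ⊗ e_S` with
`(γA⁻¹)_i ≥ 0` for all `i`. -/
def CSub (F : Type) [Field F] {ι : Type} [Fintype ι] [LinearOrder ι]
    (A : Matrix ι ι ℕ) : Submodule F (BMod F A) :=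
  Submodule.span F {x | ∃ m S, (∀ i, 0 ≤ gamRow A m.1.1 i) ∧ x = basisTensor F A m S}

/-- The projection `P^∨_{A,i}` onto the span of monomials with `(λA⁻ᵀ)_i ≠ 0`. -/
def PdualOp (F : Type) [Field F] {ι : Type} [Fintype ι] [LinearOrder ι]
    (A : Matrix ι ι ℕ) (i : ι) : RMod F A →ₗ[F] RMod F A :=
  Finsupp.linearCombination F fun m =>
    if lamRow A m.1.2 i = 0 then 0 else Finsupp.single m (1 : F)

/-- `Q^∨_{A,i} = P^∨_{A,i} ⊗ e_i^∨ e_i`. -/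
def QdualOp (F : Type) [Field F] {ι : Type} [Fintype ι] [LinearOrder ι]
    (A : Matrix ι ι ℕ) (i : ι) : BMod F A →ₗ[F] BMod F A :=
  TensorProduct.map (PdualOp F A i) ((contrE F i).comp (mulE F i))

/-- `Q_{A,i} = Id ⊗ e_i e_i^∨ + Q^∨_{A,i}`. -/
def QOp (F : Type) [Field F] {ι : Type} [Fintype ι] [LinearOrder ι]
    (A : Matrix ι ι ℕ) (i : ι) : BMod F A →ₗ[F] BMod F A :=
  TensorProduct.map LinearMap.id ((mulE F i).comp (contrE F i)) + QdualOp F A i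

/-- The underlying module of the de Rham complex `DR_A(F)`: `F[x] ⊗ ⋀(Fⁿ)`. -/
abbrev DRMod (F : Type) [Field F] (ι : Type) := TensorProduct F (MvPolynomial ι F) (ExtV F ι)

/-- The twisted de Rham differential `∑ i, D_i ⊗ e_i`, `D_i = ∂_i + π (∂_i W_A)`. -/
def dDR (F : Type) [Field F] {ι : Type} [Fintype ι] [LinearOrder ι]
    (π : F) (A : Matrix ι ι ℕ) : DRMod F ι →ₗ[F] DRMod F ι :=
  ∑ i, TensorProduct.map
    ((MvPolynomial.pderiv i).toLinearMap +
      π • LinearMap.mulLeft F (MvPolynomial.pderiv i (Wpoly F A)))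
    (mulE F i)

/-- The projection of `⋀(Fⁿ)` onto the line spanned by the basis vector `e_S`. -/
def projS (F : Type) [Field F] {ι : Type} [Fintype ι] [LinearOrder ι] (S : Finset ι) :
    ExtV F ι →ₗ[F] ExtV F ι :=
  (Pi.basisFun F (Finset ι)).constr F fun T => if T = S then Pi.single S (1 : F) else 0

/-- The chain map `Θ : DR_A(F) → B^0_A(F)`, `x^γ ⊗ e_S ↦ x^{γ + S} y^0 ⊗ e_S`. -/
def ThetaMap (F : Type) [Field F] {ι : Type} [Fintype ι] [LinearOrder ι]
    (A : Matrix ι ι ℕ) : DRMod F ι →ₗ[F] BMod F A :=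
  ∑ S : Finset ι, TensorProduct.map
    ((MvPolynomial.basisMonomials ι F).constr F fun d =>
      bE F A ((fun j => d j + (if j ∈ S then 1 else 0)), 0))
    (projS F S)

/-- The "cohomology" `ker D ∩ P / D(P)` of the differential `D` restricted to the
subcomplex `P`. -/
abbrev Hsub (F : Type) [Field F] (M : Type) [AddCommGroup M] [Module F M]
    (D : M →ₗ[F] M) (P : Submodule F M) :=
  ↥(LinearMap.ker D ⊓ P) ⧸
    Submodule.comap (LinearMap.ker D ⊓ P).subtype (Submodule.map D P)

end
noncomputable section

open DirectSum

/-- `TensorProduct.map`, specialized to the `B`-complexes. -/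
def mapB {F : Type} [Field F] {ι κ : Type} [Fintype ι] [LinearOrder ι]
    [Fintype κ] [LinearOrder κ] (A : Matrix ι ι ℕ) (B : Matrix κ κ ℕ)
    (T : RMod F A →ₗ[F] RMod F B) (L : ExtV F ι →ₗ[F] ExtV F κ) :
    BMod F A →ₗ[F] BMod F B :=
  TensorProduct.map T L

/-- `TensorProduct.map`, from a de Rham complex to a `B`-complex. -/
def mapDRB {F : Type} [Field F] {ι κ : Type} [Fintype ι] [LinearOrder ι]
    [Fintype κ] [LinearOrder κ] (B : Matrix κ κ ℕ)
    (T : MvPolynomial ι F →ₗ[F] RMod F B) (L : ExtV F ι →ₗ[F] ExtV F κ) :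
    DRMod F ι →ₗ[F] BMod F B :=
  TensorProduct.map T L

/-- The index set `S_λ = {i : (λA⁻ᵀ)_i = 0}`. -/
abbrev Slam {n : ℕ} (A : Matrix (Fin n) (Fin n) ℕ) (lam : Fin n → ℕ) : Type :=
  {i : Fin n // lamRow A lam i = 0}

/-- The principal submatrix `A^λ = (A_{ij})_{i,j ∈ S_λ}`. -/
def Alam {n : ℕ} (A : Matrix (Fin n) (Fin n) ℕ) (lam : Fin n → ℕ) :
    Matrix (Slam A lam) (Slam A lam) ℕ :=
  A.submatrix (fun k : Slam A lam => k.1) (fun k : Slam A lam => k.1)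

/-- Extension by zero of a vector indexed by `S_λ` to a vector indexed by `{1,…,n}`. -/
def extZero {n : ℕ} (A : Matrix (Fin n) (Fin n) ℕ) (lam : Fin n → ℕ)
    (g : Slam A lam → ℕ) : Fin n → ℕ :=
  fun j => if h : lamRow A lam j = 0 then g ⟨j, h⟩ else 0

/-- The inclusion of sets of exterior indices `S_λ ⊆ {1,…,n}`. -/
def extSet {n : ℕ} (A : Matrix (Fin n) (Fin n) ℕ) (lam : Fin n → ℕ)
    (S : Finset (Slam A lam)) : Finset (Fin n) :=
  S.map (Function.Embedding.subtype _)

/-- `R`-part of the map `B_{A^λ}(F) → B_A(F)`: `x^γ y^μ ↦ x^γ̃ y^{λ+μ̃}`. -/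
def PhiR (F : Type) [Field F] {n : ℕ} (A : Matrix (Fin n) (Fin n) ℕ)
    (lam : Fin n → ℕ) : RMod F (Alam A lam) →ₗ[F] RMod F A :=
  Finsupp.linearCombination F fun m =>
    bE F A (extZero A lam m.1.1, fun j => lam j + extZero A lam m.1.2 j)

/-- Exterior part of the map `B_{A^λ}(F) → B_A(F)`: `e_S ↦ e_S̃`. -/
def PhiE (F : Type) [Field F] {n : ℕ} (A : Matrix (Fin n) (Fin n) ℕ)
    (lam : Fin n → ℕ) : ExtV F (Slam A lam) →ₗ[F] ExtV F (Fin n) :=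
  (Pi.basisFun F (Finset (Slam A lam))).constr F fun S =>
    Pi.single (extSet A lam S) (1 : F)

/-- The map `B_{A^λ}(F) → B_A(F)`, `x^γ y^μ ⊗ e_S ↦ x^γ̃ y^{λ+μ̃} ⊗ e_S̃`. -/
def PhiLam (F : Type) [Field F] {n : ℕ} (A : Matrix (Fin n) (Fin n) ℕ)
    (lam : Fin n → ℕ) : BMod F (Alam A lam) →ₗ[F] BMod F A :=
  mapB (Alam A lam) A (PhiR F A lam) (PhiE F A lam)

/-- The canonical representatives of the classes of `G_A = ℤⁿ/ℤⁿAᵀ`: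
`0 ≤ (λA⁻ᵀ)_i < 1` for all `i`. -/
abbrev CanRep {n : ℕ} (A : Matrix (Fin n) (Fin n) ℕ) : Type :=
  {lam : Fin n → ℕ // ∀ i, 0 ≤ lamRow A lam i ∧ lamRow A lam i < 1}

/-- The unprojected orbifold de Rham complex `DR_{A^orb}(F) = ⊕_{λ ∈ G_A} DR_{A^λ}(F)`. -/
abbrev DROrb (F : Type) [Field F] {n : ℕ} (A : Matrix (Fin n) (Fin n) ℕ) : Type :=
  ⨁ (lam : CanRep A), DRMod F (Slam A lam.1)

/-- The differential of the orbifold de Rham complex, acting sector by sector. -/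
def dOrb (F : Type) [Field F] {n : ℕ} (π : F) (A : Matrix (Fin n) (Fin n) ℕ) :
    DROrb F A →ₗ[F] DROrb F A :=
  DirectSum.toModule F (CanRep A) (DROrb F A) fun lam =>
    (DirectSum.lof F (CanRep A) (fun l : CanRep A => DRMod F (Slam A l.1)) lam).comp
      (dDR F π (Alam A lam.1))

/-- The map `ι_λ : DR_{A^λ}(F) → B_A(F)`, `x^γ ⊗ e_S ↦ x^{γ̃+S̃} y^λ ⊗ e_S̃`. -/
def iotaLam (F : Type) [Field F] {n : ℕ} (A : Matrix (Fin n) (Fin n) ℕ)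
    (lam : Fin n → ℕ) : DRMod F (Slam A lam) →ₗ[F] BMod F A :=
  ∑ S : Finset (Slam A lam), mapDRB A
    ((MvPolynomial.basisMonomials (Slam A lam) F).constr F fun d =>
      bE F A (extZero A lam (fun k => d k + (if k ∈ S then 1 else 0)), lam))
    ((Pi.basisFun F (Finset (Slam A lam))).constr F fun T =>
      if T = S then Pi.single (extSet A lam S) (1 : F) else 0)

/-- The total map `∑_λ ι_λ : DR_{A^orb}(F) → B_A(F)`. -/
def iotaOrb (F : Type) [Field F] {n : ℕ} (A : Matrix (Fin n) (Fin n) ℕ) :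
    DROrb F A →ₗ[F] BMod F A :=
  DirectSum.toModule F (CanRep A) (BMod F A) fun lam => iotaLam F A lam.1

/-- The transposition map `D^A : x^γ y^λ ↦ x^λ y^γ` on monomial spaces. -/
def DAmap (F : Type) [Field F] {ι : Type} [Fintype ι] [LinearOrder ι]
    (A : Matrix ι ι ℕ) : RMod F A →ₗ[F] RMod F Aᵀ :=
  Finsupp.linearCombination F fun m => bE F Aᵀ (m.1.2, m.1.1)

/-- Berglund–Hübsch duality map `Δ^A = D^A ⊗ *^A`. -/
def DeltaMap (F : Type) [Field F] {ι : Type} [Fintype ι] [LinearOrder ι]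
    (π : F) (A : Matrix ι ι ℕ) : BMod F A →ₗ[F] BMod F Aᵀ :=
  mapB A Aᵀ (DAmap F A) (starA F π A)

end

noncomputable section

section Perturbation

open Module

variable {F V B : Type} [Field F] [AddCommGroup V] [Module F V]

/-- A square-zero endomorphism whose kernel is spanned by its image and `T` admits a contraction
onto `T`. -/
theorem exists_contraction (D : End F V) (hD : D * D = 0) (T : Submodule F V)
    (hT : LinearMap.ker D ≤ LinearMap.range D ⊔ T) :
    ∃ h p : End F V, D * h + h * D = 1 - p ∧ ∀ v, p v ∈ T := by
  obtain ⟨r, hr⟩ := D.rangeRestrict.exists_rightInverse_of_surjective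
    (LinearMap.range_eq_top.2 D.surjective_rangeRestrict)
  have hr' : ∀ y : LinearMap.range D, D (r y) = y := fun y =>
    congrArg Subtype.val (LinearMap.congr_fun hr y)
  let q : T →ₗ[F] V ⧸ LinearMap.range D := (LinearMap.range D).mkQ ∘ₗ T.subtype
  obtain ⟨s, hs⟩ := q.rangeRestrict.exists_rightInverse_of_surjective
    (LinearMap.range_eq_top.2 q.surjective_rangeRestrict)
  obtain ⟨s', hs'⟩ := LinearMap.exists_extend s
  let β : End F V := T.subtype ∘ₗ s' ∘ₗ (LinearMap.range D).mkQ
  obtain ⟨r', hr''⟩ := LinearMap.exists_extend r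
  have hβD : ∀ v, β (D v) = 0 := fun v => by
    have : (LinearMap.range D).mkQ (D v) = 0 := by simp
    simp only [β, LinearMap.comp_apply, this, map_zero]
  have hr3 : ∀ y ∈ LinearMap.range D, D (r' y) = y := fun y hy => by
    have := LinearMap.congr_fun hr'' ⟨y, hy⟩
    simp only [LinearMap.comp_apply, Submodule.subtype_apply] at this
    rw [this, hr']
  have hβ : ∀ k, D k = 0 → k - β k ∈ LinearMap.range D := fun k hk => by
    obtain ⟨y, hy, t, ht, rfl⟩ := Submodule.mem_sup.1 (hT (LinearMap.mem_ker.2 hk))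
    rw [← Submodule.ker_mkQ (LinearMap.range D), LinearMap.mem_ker, map_sub, sub_eq_zero]
    have hq : (LinearMap.range D).mkQ (y + t) = q ⟨t, ht⟩ := by
      simp only [q, map_add, LinearMap.comp_apply, Submodule.subtype_apply]
      rw [show (LinearMap.range D).mkQ y = 0 by simpa using hy, zero_add]
    have h1 := LinearMap.congr_fun hs (q.rangeRestrict ⟨t, ht⟩)
    have h2 := LinearMap.congr_fun hs' (q.rangeRestrict ⟨t, ht⟩)
    have h3 := congrArg Subtype.val h1
    simp only [LinearMap.comp_apply, LinearMap.id_apply] at h3 h2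
    rw [← h2] at h3
    simp only [β, LinearMap.comp_apply, hq]
    exact h3.symm
  let α : End F V := r' * (1 - β)
  have hα : ∀ k, D k = 0 → D (α k) = k - β k := fun k hk => hr3 _ (hβ k hk)
  have hDD : ∀ v, D (D v) = 0 := fun v => LinearMap.congr_fun hD v
  refine ⟨α * (1 - α * D), β * (1 - α * D), ?_, fun v => (s' _).2⟩
  ext v
  have hk : D (v - α (D v)) = 0 := by
    rw [map_sub, hα _ (hDD v), hβD, sub_zero, sub_self]
  simp only [LinearMap.add_apply, Module.End.mul_apply, LinearMap.sub_apply, Module.End.one_apply,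
    hDD, map_zero, sub_zero, hα _ hk]
  abel

/-- `1 + N` is bijective when `N` is locally nilpotent. -/
theorem bijective_one_add_of_locally_nilpotent (N : End F V)
    (hN : ∀ v, ∃ k : ℕ, (N ^ k) v = 0) : Function.Bijective (1 + N : End F V) := by
  constructor
  · rw [injective_iff_map_eq_zero]
    intro v hv
    have hv' : N v = -v := by
      rw [LinearMap.add_apply, Module.End.one_apply, add_comm] at hv
      exact eq_neg_of_add_eq_zero_left hv
    have hpow : ∀ k : ℕ, (N ^ k) v = (-1 : F) ^ k • v := fun k => by
      induction k with
      | zero => simp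
      | succ k ih => rw [pow_succ', Module.End.mul_apply, ih, map_smul, hv', pow_succ]; simp
    obtain ⟨k, hk⟩ := hN v
    rw [hpow] at hk
    simpa using hk
  · have key : ∀ k : ℕ, ∀ v, (N ^ k) v = 0 → v ∈ LinearMap.range (1 + N : End F V) := by
      intro k
      induction k with
      | zero => intro v hv; simp at hv; simp [hv]
      | succ k ih =>
        intro v hv
        have h1 : N v ∈ LinearMap.range (1 + N : End F V) :=
          ih _ (by rwa [pow_succ, Module.End.mul_apply] at hv)
        have h2 := Submodule.sub_mem _ (LinearMap.mem_range_self (1 + N : End F V) v) h1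
        simpa using h2
    intro v
    obtain ⟨k, hk⟩ := hN v
    exact key k v hk

/-- The span of the basis vectors of weight `c`. -/
def weightSpace (b : Basis B F V) (w : B → ℚ) (c : ℚ) : Submodule F V :=
  Submodule.span F (b '' {j | w j = c})

theorem basis_mem_weightSpace (b : Basis B F V) (w : B → ℚ) (i : B) :
    b i ∈ weightSpace b w (w i) :=
  Submodule.subset_span ⟨i, rfl, rfl⟩

theorem map_weightSpace_le (b : Basis B F V) (w : B → ℚ) (f : End F V) (e : ℚ)
    (hf : ∀ i, f (b i) ∈ weightSpace b w (w i + e)) {c : ℚ} {v : V}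
    (hv : v ∈ weightSpace b w c) : f v ∈ weightSpace b w (c + e) := by
  have : weightSpace b w c ≤ (weightSpace b w (c + e)).comap f := by
    refine Submodule.span_le.2 ?_
    rintro _ ⟨j, rfl, rfl⟩
    exact hf j
  exact this hv

/-- The projection to the weight space of weight `c`. -/
def weightProj (b : Basis B F V) (w : B → ℚ) (c : ℚ) : End F V :=
  b.constr F fun j => if w j = c then b j else 0

theorem weightProj_mem (b : Basis B F V) (w : B → ℚ) (c : ℚ) (v : V) :
    weightProj b w c v ∈ weightSpace b w c := by
  induction b.mem_span v using Submodule.span_induction with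
  | zero => simp
  | add x y _ _ hx hy => rw [map_add]; exact Submodule.add_mem _ hx hy
  | smul a x _ hx => rw [map_smul]; exact Submodule.smul_mem _ _ hx
  | mem x hx =>
    obtain ⟨i, rfl⟩ := hx
    rw [weightProj, Basis.constr_basis]
    split_ifs with h
    · exact h ▸ basis_mem_weightSpace b w i
    · exact Submodule.zero_mem _

theorem weightProj_of_mem (b : Basis B F V) (w : B → ℚ) {c : ℚ} (c' : ℚ) {v : V}
    (hv : v ∈ weightSpace b w c) : weightProj b w c' v = if c = c' then v else 0 := by
  induction hv using Submodule.span_induction with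
  | mem x hx =>
    obtain ⟨j, rfl, rfl⟩ := hx
    rw [weightProj, Basis.constr_basis]
  | zero => simp
  | add x y _ _ hx hy => rw [map_add, hx, hy]; split_ifs <;> simp
  | smul a x _ hx => rw [map_smul, hx]; split_ifs <;> simp

theorem weightProj_comm (b : Basis B F V) (w : B → ℚ) (f : End F V) (e : ℚ)
    (hf : ∀ i, f (b i) ∈ weightSpace b w (w i + e)) (c : ℚ) (v : V) :
    weightProj b w (c + e) (f v) = f (weightProj b w c v) := by
  have : weightProj b w (c + e) ∘ₗ f = f ∘ₗ weightProj b w c := by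
    refine b.ext fun i => ?_
    simp only [LinearMap.comp_apply]
    rw [weightProj_of_mem b w _ (hf i), weightProj_of_mem b w _ (basis_mem_weightSpace b w i)]
    split_ifs <;> simp_all
  exact LinearMap.congr_fun this v

/-- The homogeneous component of degree `e` of an endomorphism. -/
def homogPart (b : Basis B F V) (w : B → ℚ) (e : ℚ) (f : End F V) : End F V :=
  b.constr F fun i => weightProj b w (w i + e) (f (b i))

theorem homogPart_of_mem (b : Basis B F V) (w : B → ℚ) (e : ℚ) (f : End F V) {c : ℚ} {v : V}
    (hv : v ∈ weightSpace b w c) : homogPart b w e f v = weightProj b w (c + e) (f v) := by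
  induction hv using Submodule.span_induction with
  | mem x hx =>
    obtain ⟨j, rfl, rfl⟩ := hx
    rw [homogPart, Basis.constr_basis]
  | zero => simp
  | add x y _ _ hx hy => rw [map_add, hx, hy, map_add, map_add]
  | smul a x _ hx => rw [map_smul, hx, map_smul, map_smul]

/-- A perturbation `D₀` of a differential `D₁` that has smaller degree and vanishes on
representatives of the cohomology of `D₁` can be conjugated away. -/
theorem exists_conj_of_perturbation (b : Basis B F V) (w : B → ℚ) (hw : ∀ i, 0 ≤ w i)
    (D₁ D₀ : End F V) (hD₁ : D₁ * D₁ = 0) (hD : (D₁ + D₀) * (D₁ + D₀) = 0)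
    (T : Submodule F V) (hT₀ : ∀ t ∈ T, D₀ t = 0)
    (hT : LinearMap.ker D₁ ≤ LinearMap.range D₁ ⊔ T)
    (h₁ : ∀ i, D₁ (b i) ∈ weightSpace b w (w i + 1))
    (h₀ : ∀ i, D₀ (b i) ∈ weightSpace b w (w i + 0)) :
    ∃ U : V ≃ₗ[F] V, ∀ v, (D₁ + D₀) (U v) = U (D₁ v) := by
  obtain ⟨h, p, hhp, hp⟩ := exists_contraction D₁ hD₁ T hT
  let h' := homogPart b w (-1) h
  let p' := homogPart b w 0 p
  have hp' : D₀ * p' = 0 := by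
    refine b.ext fun i => ?_
    rw [Module.End.mul_apply, homogPart_of_mem b w 0 p (basis_mem_weightSpace b w i),
      ← weightProj_comm b w D₀ 0 h₀, hT₀ _ (hp _), map_zero, LinearMap.zero_apply]
  have hh' : D₁ * h' + h' * D₁ = 1 - p' := by
    refine b.ext fun i => ?_
    have hi := basis_mem_weightSpace b w i
    have h2 := LinearMap.congr_fun hhp (b i)
    simp only [LinearMap.add_apply, Module.End.mul_apply, LinearMap.sub_apply,
      Module.End.one_apply] at h2 ⊢
    rw [homogPart_of_mem b w (-1) h hi, homogPart_of_mem b w (-1) h (h₁ i),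
      homogPart_of_mem b w 0 p hi, ← weightProj_comm b w D₁ 1 h₁]
    have e1 : w i + -1 + 1 = w i + 0 := by ring
    have e2 : w i + 1 + -1 = w i + 0 := by ring
    rw [e1, e2, ← map_add, h2, map_sub, weightProj_of_mem b w _ hi, if_pos (add_zero _).symm]
  have hdeg : ∀ (c : ℚ) (v : V), v ∈ weightSpace b w c →
      (D₀ * h') v ∈ weightSpace b w (c + -1) := fun c v hv => by
    rw [Module.End.mul_apply, homogPart_of_mem b w (-1) h hv]
    simpa using map_weightSpace_le b w D₀ 0 h₀ (weightProj_mem b w (c + -1) (h v))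
  have hneg : ∀ (c : ℚ) (v : V), c < 0 → v ∈ weightSpace b w c → v = 0 := fun c v hc hv => by
    have : {j | w j = c} = ∅ := by
      ext j
      simp only [Set.mem_ofPred_eq, Set.mem_empty_iff_false, iff_false]
      intro hj
      linarith [hw j]
    simpa [weightSpace, this] using hv
  have hnil : ∀ v, ∃ k : ℕ, ((D₀ * h') ^ k) v = 0 := by
    intro v
    induction b.mem_span v using Submodule.span_induction with
    | zero => exact ⟨0, by simp⟩
    | add x y _ _ hx hy =>
      obtain ⟨k, hk⟩ := hx
      obtain ⟨l, hl⟩ := hy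
      refine ⟨k + l, ?_⟩
      rw [map_add, add_comm k l, pow_add, Module.End.mul_apply, hk, map_zero, zero_add,
        ← pow_add, add_comm l k, pow_add, Module.End.mul_apply, hl, map_zero]
    | smul a x _ hx =>
      obtain ⟨k, hk⟩ := hx
      exact ⟨k, by rw [map_smul, hk, smul_zero]⟩
    | mem x hx =>
      obtain ⟨i, rfl⟩ := hx
      have hk : ∀ k : ℕ, ((D₀ * h') ^ k) (b i) ∈ weightSpace b w (w i - k) := fun k => by
        induction k with
        | zero => simpa using basis_mem_weightSpace b w i
        | succ k ih =>
          rw [pow_succ', Module.End.mul_apply]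
          have := hdeg _ _ ih
          convert this using 2
          push_cast
          ring
      obtain ⟨k, hk'⟩ := exists_nat_gt (w i)
      exact ⟨k, hneg _ _ (by linarith) (hk k)⟩
  refine ⟨LinearEquiv.ofBijective _ (bijective_one_add_of_locally_nilpotent _ hnil), fun v => ?_⟩
  have key : (D₁ + D₀) * (1 + D₀ * h') = (1 + D₀ * h') * D₁ := by
    have e3 : h' * D₁ = 1 - p' - D₁ * h' := by rw [← hh']; abel
    have e4 : (D₁ + D₀) * D₀ = - (D₀ * D₁) := by
      have h5 : (D₁ + D₀) * (D₁ + D₀) = D₁ * D₁ + D₀ * D₁ + (D₁ + D₀) * D₀ := by noncomm_ring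
      rw [hD, hD₁, zero_add] at h5
      exact eq_neg_of_add_eq_zero_right h5.symm
    calc (D₁ + D₀) * (1 + D₀ * h') = D₁ + D₀ + (D₁ + D₀) * D₀ * h' := by noncomm_ring
      _ = D₁ + D₀ - D₀ * D₁ * h' - D₀ * p' := by rw [e4, hp']; noncomm_ring
      _ = D₁ + D₀ * (1 - p' - D₁ * h') := by noncomm_ring
      _ = _ := by rw [← e3]; noncomm_ring
  exact LinearMap.congr_fun key v

end Perturbation

section Clifford

open Module

variable {F ι M : Type} [Field F] [LinearOrder ι] [AddCommGroup M] [Module F M]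

/-- The sign `(-1)^#{x ∈ S | x < i}`. -/
def extSign (F : Type) [Field F] {ι : Type} [LinearOrder ι] (i : ι) (S : Finset ι) : F :=
  (-1) ^ (S.filter (· < i)).card

theorem extSign_mul_self (i : ι) (S : Finset ι) : extSign F i S * extSign F i S = 1 := by
  rw [extSign, ← mul_pow]
  simp

theorem extSign_insert {i j : ι} {S : Finset ι} (hj : j ∉ S) :
    extSign F i (insert j S) = if j < i then -extSign F i S else extSign F i S := by
  unfold extSign
  rw [Finset.filter_insert]
  split_ifs with h
  · rw [Finset.card_insert_of_notMem (by simp [hj]), pow_succ]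
    simp
  · rfl

theorem extSign_erase {i j : ι} {S : Finset ι} (hj : j ∈ S) :
    extSign F i (S.erase j) = if j < i then -extSign F i S else extSign F i S := by
  have h := extSign_insert (F := F) (i := i) (Finset.notMem_erase j S)
  rw [Finset.insert_erase hj] at h
  split_ifs at h ⊢ <;> simp [h]

/-- The operator `f ⊗ e_i` on `M ⊗ ⋀(Fⁿ)`, viewed as the space of functions `Finset ι → M`. -/
def raise (i : ι) (f : End F M) : End F (Finset ι → M) where
  toFun v S := if i ∈ S then extSign F i S • f (v (S.erase i)) else 0
  map_add' v w := by
    funext S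
    by_cases h : i ∈ S <;> simp [h]
  map_smul' a v := by
    funext S
    by_cases h : i ∈ S <;> simp [h, smul_comm (extSign F i S) a]

/-- The operator `f ⊗ e_i^∨` on `M ⊗ ⋀(Fⁿ)`, viewed as the space of functions `Finset ι → M`. -/
def lower (i : ι) (f : End F M) : End F (Finset ι → M) where
  toFun v S := if i ∈ S then 0 else extSign F i S • f (v (insert i S))
  map_add' v w := by
    funext S
    by_cases h : i ∈ S <;> simp [h]
  map_smul' a v := by
    funext S
    by_cases h : i ∈ S <;> simp [h, smul_comm (extSign F i S) a]

theorem raise_apply (i : ι) (f : End F M) (v : Finset ι → M) (S : Finset ι) :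
    raise i f v S = if i ∈ S then extSign F i S • f (v (S.erase i)) else 0 := rfl

theorem lower_apply (i : ι) (f : End F M) (v : Finset ι → M) (S : Finset ι) :
    lower i f v S = if i ∈ S then 0 else extSign F i S • f (v (insert i S)) := rfl

theorem raise_add (i : ι) (f g : End F M) : raise i (f + g) = raise i f + raise i g := by
  refine LinearMap.ext fun v => ?_
  funext S
  simp only [raise_apply, LinearMap.add_apply, Pi.add_apply]
  split_ifs <;> simp

theorem lower_add (i : ι) (f g : End F M) : lower i (f + g) = lower i f + lower i g := by
  refine LinearMap.ext fun v => ?_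
  funext S
  simp only [lower_apply, LinearMap.add_apply, Pi.add_apply]
  split_ifs <;> simp

theorem raise_mul_self (i : ι) (f g : End F M) : raise i f * raise i g = 0 := by
  refine LinearMap.ext fun v => ?_
  funext S
  simp [raise_apply]

theorem lower_mul_self (i : ι) (f g : End F M) : lower i f * lower i g = 0 := by
  refine LinearMap.ext fun v => ?_
  funext S
  simp [lower_apply]

/-- The general form of the anticommutator of two raising operators. -/
theorem raise_raise_apply {i j : ι} (hij : i ≠ j) (f g : End F M) (v : Finset ι → M)
    (S : Finset ι) : (raise i f * raise j g + raise j g * raise i f) v S =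
      if i ∈ S ∧ j ∈ S then (extSign F i S * extSign F j (S.erase i)) •
        ((f * g - g * f) (v ((S.erase i).erase j))) else 0 := by
  simp only [LinearMap.add_apply, Pi.add_apply, Module.End.mul_apply, raise_apply,
    LinearMap.sub_apply, Finset.mem_erase]
  by_cases hi : i ∈ S
  · by_cases hj : j ∈ S
    · simp only [hi, hj, hij, hij.symm, ne_eq, not_false_eq_true, and_self, if_true, map_smul,
        smul_smul]
      rw [Finset.erase_right_comm (a := j), extSign_erase hi, extSign_erase hj]
      rcases hij.lt_or_gt with h | h
      · simp only [h, h.not_gt, if_true, if_false, smul_sub]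
        simp only [mul_neg, neg_smul, mul_comm]
        abel
      · simp only [h, h.not_gt, if_true, if_false, smul_sub]
        simp only [mul_neg, neg_smul, mul_comm]
        abel
    · simp [hi, hj]
  · simp [hi]

theorem raise_anticomm {i j : ι} (hij : i ≠ j) {f g : End F M} (hfg : f * g = g * f) :
    raise i f * raise j g + raise j g * raise i f = 0 := by
  refine LinearMap.ext fun v => ?_
  funext S
  rw [raise_raise_apply hij, hfg]
  simp

theorem lower_anticomm {i j : ι} (hij : i ≠ j) {f g : End F M} (hfg : f * g = g * f) :
    lower i f * lower j g + lower j g * lower i f = 0 := by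
  refine LinearMap.ext fun v => ?_
  funext S
  simp only [LinearMap.add_apply, Pi.add_apply, Module.End.mul_apply, lower_apply,
    LinearMap.zero_apply, Pi.zero_apply, Finset.mem_insert]
  by_cases hi : i ∈ S
  · simp [hi]
  · by_cases hj : j ∈ S
    · simp [hi, hj]
    · have hfg' : ∀ m, f (g m) = g (f m) := fun m => LinearMap.congr_fun hfg m
      simp only [hi, hj, hij, hij.symm, or_self, if_false, map_smul, smul_smul]
      rw [Finset.insert_comm j i, extSign_insert hi, extSign_insert hj, hfg']
      rcases hij.lt_or_gt with h | h <;>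
        simp [h, h.not_gt, mul_comm]

theorem raise_lower_anticomm {i j : ι} (hij : i ≠ j) {f g : End F M} (hfg : f * g = g * f) :
    raise i f * lower j g + lower j g * raise i f = 0 := by
  refine LinearMap.ext fun v => ?_
  funext S
  simp only [LinearMap.add_apply, Pi.add_apply, Module.End.mul_apply, lower_apply, raise_apply,
    LinearMap.zero_apply, Pi.zero_apply, Finset.mem_insert, Finset.mem_erase]
  by_cases hi : i ∈ S
  · by_cases hj : j ∈ S
    · simp [hi, hj, hij.symm]
    · have hfg' : ∀ m, f (g m) = g (f m) := fun m => LinearMap.congr_fun hfg m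
      simp only [hi, hj, hij, or_true, and_false, if_true, if_false, map_smul, smul_smul]
      rw [Finset.erase_insert_of_ne hij.symm, extSign_insert hj, extSign_erase hi, hfg']
      rcases hij.lt_or_gt with h | h <;>
        simp [h, h.not_gt, mul_comm]
  · simp [hi, hij]

theorem raise_lower_self_apply (i : ι) (f g : End F M) (v : Finset ι → M) (S : Finset ι) :
    (raise i f * lower i g + lower i g * raise i f) v S =
      if i ∈ S then f (g (v S)) else g (f (v S)) := by
  simp only [LinearMap.add_apply, Pi.add_apply, Module.End.mul_apply, lower_apply, raise_apply]
  by_cases hi : i ∈ S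
  · simp only [hi, if_true, if_false, Finset.notMem_erase, Finset.insert_erase, map_smul,
      smul_smul, extSign_erase hi, lt_irrefl, extSign_mul_self, one_smul, add_zero]
  · simp only [hi, if_true, if_false, Finset.mem_insert_self, Finset.erase_insert,
      not_false_eq_true, map_smul, smul_smul, extSign_insert hi, lt_irrefl, extSign_mul_self,
      one_smul, zero_add]

theorem sum_mul_sum_eq_zero_of_anticomm {R κ : Type} [Ring R] (s : Finset κ) (d : κ → R)
    (h₁ : ∀ i, d i * d i = 0) (h₂ : ∀ i j, i ≠ j → d i * d j + d j * d i = 0) :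
    (∑ i ∈ s, d i) * ∑ i ∈ s, d i = 0 := by
  induction s using Finset.induction with
  | empty => simp
  | insert k s hk ih =>
    rw [Finset.sum_insert hk, add_mul, mul_add, mul_add, h₁, ih, zero_add, add_zero,
      Finset.mul_sum, Finset.sum_mul, ← Finset.sum_add_distrib]
    exact Finset.sum_eq_zero fun i hi => h₂ k i (by rintro rfl; exact hk hi)

variable [Fintype ι]

/-- The operator `∑ i, f_i ⊗ e_i + g_i ⊗ e_i^∨`. -/
def cliffordDiff (f g : ι → End F M) : End F (Finset ι → M) :=
  ∑ i, (raise i (f i) + lower i (g i))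

theorem cliffordDiff_sq (f g : ι → End F M) (hf : ∀ i j, f i * f j = f j * f i)
    (hg : ∀ i j, g i * g j = g j * g i) (hfg : ∀ i j, f i * g j = g j * f i)
    (h : ∀ i, f i * g i = 0) : cliffordDiff f g * cliffordDiff f g = 0 := by
  refine sum_mul_sum_eq_zero_of_anticomm _ _ (fun i => ?_) fun i j hij => ?_
  · have h1 : raise i (f i) * lower i (g i) + lower i (g i) * raise i (f i) = 0 := by
      refine LinearMap.ext fun v => ?_
      funext S
      rw [raise_lower_self_apply, ← Module.End.mul_apply, ← Module.End.mul_apply, ← hfg, h]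
      simp
    rw [add_mul, mul_add, mul_add, raise_mul_self, lower_mul_self, zero_add, add_zero, h1]
  · have e1 := raise_anticomm hij (hf i j)
    have e2 := lower_anticomm hij (hg i j)
    have e3 := raise_lower_anticomm hij (hfg i j)
    have e4 := raise_lower_anticomm hij.symm (hfg j i)
    calc _ = (raise i (f i) * raise j (f j) + raise j (f j) * raise i (f i)) +
          (lower i (g i) * lower j (g j) + lower j (g j) * lower i (g i)) +
          (raise i (f i) * lower j (g j) + lower j (g j) * raise i (f i)) +
          (raise j (f j) * lower i (g i) + lower i (g i) * raise j (f j)) := by noncomm_ring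
      _ = 0 := by rw [e1, e2, e3, e4]; simp

end Clifford

section Koszul

open Module

variable {F ι R : Type} [Field F] [LinearOrder ι] [CommRing R] [Algebra F R]

/-- The Koszul differential `∑_{i ∈ U} a_i ⊗ e_i`. -/
def koszulDiff (F : Type) {ι R : Type} [Field F] [LinearOrder ι] [CommRing R] [Algebra F R]
    (a : ι → R) (U : Finset ι) : End F (Finset ι → R) :=
  ∑ i ∈ U, raise i (LinearMap.mulLeft F (a i))

theorem koszulDiff_apply (a : ι → R) (U : Finset ι) (v : Finset ι → R) (S : Finset ι) :
    koszulDiff F a U v S =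
      ∑ i ∈ U, if i ∈ S then extSign F i S • (a i * v (S.erase i)) else 0 := by
  simp only [koszulDiff, LinearMap.sum_apply, Finset.sum_apply, raise_apply,
    LinearMap.mulLeft_apply]

theorem koszulDiff_smul (a : ι → R) (U : Finset ι) (r : R) (v : Finset ι → R) :
    koszulDiff F a U (r • v) = r • koszulDiff F a U v := by
  funext S
  simp only [koszulDiff_apply, Pi.smul_apply, smul_eq_mul, Finset.mul_sum]
  refine Finset.sum_congr rfl fun i _ => ?_
  split_ifs
  · rw [mul_left_comm, mul_smul_comm]
  · simp

theorem koszulDiff_apply_mem_span (a : ι → R) (U : Finset ι) (v : Finset ι → R) (S : Finset ι) :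
    koszulDiff F a U v S ∈ Ideal.span (a '' U) := by
  rw [koszulDiff_apply]
  refine Submodule.sum_mem _ fun i hi => ?_
  split_ifs
  · rw [mul_comm, ← smul_mul_assoc]
    exact Ideal.mul_mem_left _ _ (Ideal.subset_span ⟨i, hi, rfl⟩)
  · exact Submodule.zero_mem _

/-- The elements of `R ⊗ ⋀(F^U)` inside `R ⊗ ⋀(Fⁿ)`. -/
def extSupported (F : Type) {ι : Type} (R : Type) [Field F] [CommRing R] [Algebra F R]
    (U : Finset ι) : Submodule F (Finset ι → R) where
  carrier := {v | ∀ S, ¬ S ⊆ U → v S = 0}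
  add_mem' hv hw S hS := by simp [hv S hS, hw S hS]
  zero_mem' _ _ := rfl
  smul_mem' a v hv S hS := by simp [hv S hS]

theorem single_mem_extSupported {S U : Finset ι} (h : S ⊆ U) (r : R) :
    Pi.single S r ∈ extSupported F R U := fun T hT => by
  rw [Pi.single_eq_of_ne]
  rintro rfl
  exact hT h

theorem exists_koszulDiff_eq_single (a : ι → R) (U : Finset ι) {r : R}
    (hr : r ∈ Ideal.span (a '' U)) :
    ∃ w ∈ extSupported F R U, koszulDiff F a U w = Pi.single U r := by
  induction hr using Submodule.span_induction with
  | mem x hx =>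
    obtain ⟨i, hi, rfl⟩ := hx
    have hi' : i ∈ U := hi
    refine ⟨Pi.single (U.erase i) (extSign F i U • 1),
      single_mem_extSupported (Finset.erase_subset i U) _, ?_⟩
    funext S
    rw [koszulDiff_apply]
    by_cases hS : S = U
    · subst hS
      rw [Pi.single_eq_same, Finset.sum_eq_single i]
      · simp [hi', smul_smul, extSign_mul_self]
      · intro j hj hji
        have : S.erase j ≠ S.erase i := fun h => by
          have : i ∈ S.erase j := Finset.mem_erase.2 ⟨hji.symm, hi'⟩
          rw [h] at this
          exact Finset.notMem_erase i S this
        simp [Pi.single_eq_of_ne this]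
      · exact fun h => absurd hi' h
    · rw [Pi.single_eq_of_ne hS]
      refine Finset.sum_eq_zero fun j hj => ?_
      split_ifs with hjS
      · by_cases h : S.erase j = U.erase i
        · exfalso
          by_cases hji : j = i
          · subst hji
            exact hS (by rw [← Finset.insert_erase hjS, h, Finset.insert_erase hi'])
          · have : j ∈ U.erase i := Finset.mem_erase.2 ⟨hji, hj⟩
            rw [← h] at this
            exact Finset.notMem_erase j S this
        · simp [Pi.single_eq_of_ne h]
      · rfl
  | zero => exact ⟨0, Submodule.zero_mem _, by simp⟩
  | add x y _ _ hx hy =>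
    obtain ⟨w, hw, h⟩ := hx
    obtain ⟨w', hw', h'⟩ := hy
    exact ⟨w + w', Submodule.add_mem _ hw hw', by rw [map_add, h, h', Pi.single_add]⟩
  | smul c x _ hx =>
    obtain ⟨w, hw, h⟩ := hx
    refine ⟨c • w, fun S hS => by simp [hw S hS], ?_⟩
    rw [koszulDiff_smul, h, Pi.single_smul]

theorem koszulDiff_anticomm_raise (a : ι → R) {U : Finset ι} {k : ι} (hk : k ∉ U) :
    koszulDiff F a U * raise k 1 + raise k 1 * koszulDiff F a U = 0 := by
  rw [koszulDiff, Finset.sum_mul, Finset.mul_sum, ← Finset.sum_add_distrib]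
  exact Finset.sum_eq_zero fun i hi =>
    raise_anticomm (by rintro rfl; exact hk hi) (by rw [mul_one, one_mul])

theorem koszulDiff_anticomm_lower (a : ι → R) {U : Finset ι} {k : ι} (hk : k ∉ U) :
    koszulDiff F a U * lower k 1 + lower k 1 * koszulDiff F a U = 0 := by
  rw [koszulDiff, Finset.sum_mul, Finset.mul_sum, ← Finset.sum_add_distrib]
  exact Finset.sum_eq_zero fun i hi =>
    raise_lower_anticomm (by rintro rfl; exact hk hi) (by rw [mul_one, one_mul])

/-- The Koszul complex of a regular sequence is exact except in top degree. -/
theorem koszulDiff_exact (a : ι → R) (U : Finset ι)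
    (reg : ∀ i ∈ U, ∀ r, a i * r ∈ Ideal.span (a '' {j | j ∈ U ∧ j < i}) →
      r ∈ Ideal.span (a '' {j | j ∈ U ∧ j < i})) :
    ∀ v ∈ extSupported F R U, koszulDiff F a U v = 0 →
      ∃ u ∈ extSupported F R U, ∃ r, v = koszulDiff F a U u + Pi.single U r := by
  induction U using Finset.induction_on_max with
  | empty =>
    intro v hv _
    refine ⟨0, Submodule.zero_mem _, v ∅, ?_⟩
    funext S
    by_cases hS : S = ∅
    · subst hS; simp
    · simp [Pi.single_eq_of_ne hS, hv S (by simpa using hS)]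
  | insert k U hlt ih =>
    have hk : k ∉ U := fun h => lt_irrefl _ (hlt k h)
    have ih := ih fun i hi => by
      have : {j | j ∈ insert k U ∧ j < i} = {j | j ∈ U ∧ j < i} := by
        ext j
        simp only [Finset.mem_insert, Set.mem_ofPred_eq]
        refine ⟨fun h => ⟨h.1.resolve_left ?_, h.2⟩, fun h => ⟨Or.inr h.1, h.2⟩⟩
        rintro rfl
        exact (hlt i hi).not_gt h.2
      simpa only [this] using reg i (Finset.mem_insert_of_mem hi)
    have regk : ∀ r, a k * r ∈ Ideal.span (a '' U) → r ∈ Ideal.span (a '' U) := by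
      have : {j | j ∈ insert k U ∧ j < k} = (U : Set ι) := by
        ext j
        simp only [Finset.mem_insert, Set.mem_ofPred_eq, Finset.mem_coe]
        refine ⟨fun h => h.1.resolve_left h.2.ne, fun h => ⟨Or.inr h, hlt j h⟩⟩
      simpa only [this] using reg k (Finset.mem_insert_self k U)
    intro v hv hκ
    set κ := koszulDiff F a U with hκdef
    let e : End F (Finset ι → R) := raise k 1
    let c : End F (Finset ι → R) := lower k 1
    have hins : ∀ u, koszulDiff F a (insert k U) u = κ u + a k • e u := fun u => by
      rw [koszulDiff, Finset.sum_insert hk, add_comm]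
      change κ u + raise k (LinearMap.mulLeft F (a k)) u = _
      refine congrArg (κ u + ·) ?_
      funext S
      simp only [e, raise_apply, Pi.smul_apply, LinearMap.mulLeft_apply, Module.End.one_apply,
        smul_eq_mul]
      split_ifs
      · rw [mul_smul_comm]
      · simp
    have hc_smul : ∀ (r : R) u, c (r • u) = r • c u := fun r u => by
      funext S
      simp only [c, lower_apply, Pi.smul_apply, Module.End.one_apply, smul_eq_mul]
      split_ifs
      · simp
      · rw [mul_smul_comm]
    have he_smul : ∀ (r : R) u, e (r • u) = r • e u := fun r u => by
      funext S
      simp only [e, raise_apply, Pi.smul_apply, Module.End.one_apply, smul_eq_mul]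
      split_ifs
      · rw [mul_smul_comm]
      · simp
    have hκe : ∀ u, κ (e u) = - e (κ u) := fun u =>
      eq_neg_of_add_eq_zero_left (LinearMap.congr_fun (koszulDiff_anticomm_raise (F := F) a hk) u)
    have hκc : ∀ u, κ (c u) = - c (κ u) := fun u =>
      eq_neg_of_add_eq_zero_left (LinearMap.congr_fun (koszulDiff_anticomm_lower (F := F) a hk) u)
    have hee : ∀ u, e (e u) = 0 := fun u => LinearMap.congr_fun (raise_mul_self k _ _) u
    have hec : ∀ u, e (c u) + c (e u) = u := fun u => by
      funext S
      have := raise_lower_self_apply (F := F) k 1 1 u S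
      simpa using this
    have hv₀ : c (e v) ∈ extSupported F R U := fun S hS => by
      simp only [c, e, lower_apply, raise_apply, Finset.mem_insert_self, if_true]
      split_ifs with hkS
      · rfl
      · rw [Module.End.one_apply, Module.End.one_apply, Finset.erase_insert hkS, hv, smul_zero,
          smul_zero]
        exact fun h => hS ((Finset.subset_insert_iff_of_notMem hkS).1 h)
    have hv₁ : c v ∈ extSupported F R U := fun S hS => by
      simp only [c, lower_apply]
      split_ifs with hkS
      · rfl
      · rw [Module.End.one_apply, hv, smul_zero]
        exact fun h => hS ((Finset.subset_insert_iff_of_notMem hkS).1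
          ((Finset.subset_insert k S).trans h))
    rw [hins] at hκ
    have hκ₁ : κ (c v) = a k • c (e v) := by
      rw [hκc, eq_neg_of_add_eq_zero_left hκ, map_neg, neg_neg, hc_smul]
    have hκ₀ : κ (c (e v)) = 0 := by
      rw [hκc, hκe, eq_neg_of_add_eq_zero_left hκ]
      simp only [map_neg, he_smul, hee, smul_zero, neg_zero, map_zero]
    obtain ⟨u₀, hu₀, r, hr⟩ := ih _ hv₀ hκ₀
    have hrmem : r ∈ Ideal.span (a '' U) := by
      refine regk r ?_
      have h1 := congrFun hκ₁ U
      rw [hr] at h1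
      simp only [Pi.smul_apply, Pi.add_apply, Pi.single_eq_same, smul_eq_mul, mul_add] at h1
      rw [← sub_eq_iff_eq_add'.2 h1]
      exact Ideal.sub_mem _ (koszulDiff_apply_mem_span a U _ U)
        (Ideal.mul_mem_left _ _ (koszulDiff_apply_mem_span a U _ U))
    obtain ⟨w, hw, hκw⟩ := exists_koszulDiff_eq_single (F := F) a U hrmem
    have hv₀' : c (e v) = κ (u₀ + w) := by rw [map_add, hr, hκw]
    obtain ⟨u₁, hu₁, r', hr'⟩ := ih (c v - a k • (u₀ + w))
      (Submodule.sub_mem _ hv₁ fun S hS => by simp [hu₀ S hS, hw S hS])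
      (by rw [map_sub, koszulDiff_smul, hκ₁, hv₀', sub_self])
    have hmono : extSupported F R U ≤ extSupported F R (insert k U) := fun u hu S hS =>
      hu S fun h => hS (h.trans (Finset.subset_insert k U))
    have heu : ∀ u ∈ extSupported F R U, e u ∈ extSupported F R (insert k U) := fun u hu S hS => by
      simp only [e, raise_apply]
      split_ifs
      · rw [Module.End.one_apply, hu, smul_zero]
        exact fun h => hS (Finset.subset_insert_iff.2 h)
      · rfl
    have hesingle : e (Pi.single U r') = Pi.single (insert k U) (extSign F k (insert k U) • r') := by
      funext S
      simp only [e, raise_apply, Module.End.one_apply]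
      by_cases hS : S = insert k U
      · subst hS
        simp [hk]
      · rw [Pi.single_eq_of_ne hS]
        split_ifs with hkS
        · rw [Pi.single_eq_of_ne, smul_zero]
          rintro rfl
          exact hS (Finset.insert_erase hkS).symm
        · rfl
    refine ⟨u₀ + w - e u₁, Submodule.sub_mem _ (hmono (Submodule.add_mem _ hu₀ hw)) (heu _ hu₁),
      extSign F k (insert k U) • r', ?_⟩
    rw [← hesingle, hins, map_sub κ, ← hv₀', hκe, map_sub e, hee, sub_zero, sub_neg_eq_add]
    conv_lhs => rw [← hec v, eq_add_of_sub_eq hr', map_add, map_add, he_smul]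
    abel

end Koszul

section MonomialModel

open Module

variable {F ι : Type} [Field F]

/-- The operator `m ↦ c m • (m + t)` on the space with basis `ι → ℤ`. An exponent `m` stands for
the monomial `x^γ z^μ`, where `γ` and `μ` are the positive and negative parts of `m`. -/
def monoOp (c : (ι → ℤ) → F) (t : ι → ℤ) : End F ((ι → ℤ) →₀ F) :=
  Finsupp.linearCombination F fun m => Finsupp.single (m + t) (c m)

theorem monoOp_single (c : (ι → ℤ) → F) (t m : ι → ℤ) (a : F) :
    monoOp c t (Finsupp.single m a) = Finsupp.single (m + t) (a * c m) := by
  simp [monoOp]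

theorem monoOp_mul (c d : (ι → ℤ) → F) (t s : ι → ℤ) :
    monoOp c t * monoOp d s = monoOp (fun m => d m * c (m + s)) (t + s) := by
  refine Finsupp.lhom_ext fun m a => ?_
  rw [Module.End.mul_apply, monoOp_single, monoOp_single, monoOp_single, mul_assoc,
    add_comm t s, add_assoc]

theorem monoOp_comm {c d : (ι → ℤ) → F} {t s : ι → ℤ}
    (h : ∀ m, d m * c (m + s) = c m * d (m + t)) : Commute (monoOp c t) (monoOp d s) := by
  rw [Commute, SemiconjBy, monoOp_mul, monoOp_mul, add_comm t s]
  exact congrArg (monoOp · _) (funext h)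

theorem monoOp_mul_eq_zero {c d : (ι → ℤ) → F} {t s : ι → ℤ}
    (h : ∀ m, d m * c (m + s) = 0) : monoOp c t * monoOp d s = 0 := by
  rw [monoOp_mul]
  refine Finsupp.lhom_ext fun m a => ?_
  rw [monoOp_single, h]
  simp

/-- `x^γ z^μ ↦ γ_i x^γ z^μ`. -/
def thetaZ (F : Type) [Field F] {ι : Type} (i : ι) : End F ((ι → ℤ) →₀ F) :=
  monoOp (fun m => ((m i).toNat : F)) 0

/-- `x^γ z^μ ↦ ρ μ_i x^γ z^μ`. -/
def tdualZ {F : Type} [Field F] {ι : Type} (ρ : F) (i : ι) : End F ((ι → ℤ) →₀ F) :=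
  monoOp (fun m => ρ * ((-m i).toNat : F)) 0

/-- Multiplication by the monomial `∏ j, x_j ^ A l j`. -/
def rowZ (F : Type) [Field F] {ι : Type} (A : Matrix ι ι ℕ) (l : ι) :
    End F ((ι → ℤ) →₀ F) :=
  monoOp (fun m => if ∀ j, 0 < A l j → 0 ≤ m j then 1 else 0) (fun j => (A l j : ℤ))

theorem commute_rowZ_rowZ (A : Matrix ι ι ℕ) (l l' : ι) :
    Commute (rowZ F A l) (rowZ F A l') := by
  refine monoOp_comm fun m => ?_
  have h : ((∀ j, 0 < A l' j → 0 ≤ m j) ∧ ∀ j, 0 < A l j → 0 ≤ m j + A l' j) ↔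
      ((∀ j, 0 < A l j → 0 ≤ m j) ∧ ∀ j, 0 < A l' j → 0 ≤ m j + A l j) := by
    constructor <;> rintro ⟨h1, h2⟩ <;> refine ⟨fun j hj => ?_, fun j hj => ?_⟩ <;>
      have := h1 j <;> have := h2 j <;> omega
  simp only [Pi.add_apply, ← ite_and, mul_ite, mul_one, mul_zero]
  simp only [and_comm] at h ⊢
  simp only [h]

theorem commute_tdualZ_rowZ (ρ : F) (A : Matrix ι ι ℕ) (i l : ι) :
    Commute (tdualZ ρ i) (rowZ F A l) := by
  refine monoOp_comm fun m => ?_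
  simp only [Pi.add_apply, Pi.zero_apply, add_zero]
  split_ifs with h
  · have : (-(m i + A l i)).toNat = (-m i).toNat := by have := h i; omega
    rw [this, mul_comm]
  · simp

theorem thetaZ_mul_rowZ (A : Matrix ι ι ℕ) (i l : ι) :
    thetaZ F i * rowZ F A l = rowZ F A l * thetaZ F i + (A l i : F) • rowZ F A l := by
  refine Finsupp.lhom_ext fun m a => ?_
  simp only [thetaZ, rowZ, Module.End.mul_apply, LinearMap.add_apply, LinearMap.smul_apply,
    monoOp_single, add_zero, Pi.add_apply, Finsupp.smul_single, ← Finsupp.single_add]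
  congr 1
  split_ifs with h
  · have : (m i + A l i).toNat = (m i).toNat + A l i := by have := h i; omega
    rw [this]
    push_cast
    simp only [smul_eq_mul]
    ring
  · simp

theorem rowZ_mul_eq_zero (A : Matrix ι ι ℕ) (i l : ι) (d : (ι → ℤ) → F) (s : ι → ℤ)
    (hd : ∀ m, d m ≠ 0 → m i + s i < 0) : (A l i : F) • (rowZ F A l * monoOp d s) = 0 := by
  by_cases hA : A l i = 0
  · simp [hA]
  · rw [rowZ, monoOp_mul_eq_zero, smul_zero]
    intro m
    by_cases hm : d m = 0
    · simp [hm]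
    · rw [if_neg, mul_zero]
      intro h
      have h1 := h i (Nat.pos_of_ne_zero hA)
      have h2 := hd m hm
      rw [Pi.add_apply] at h1
      omega

theorem thetaZ_mul_tdualZ (ρ : F) (i : ι) : thetaZ F i * tdualZ ρ i = 0 := by
  refine monoOp_mul_eq_zero fun m => ?_
  simp only [Pi.add_apply, Pi.zero_apply, add_zero]
  rcases le_total (m i) 0 with h | h
  · rw [Int.toNat_of_nonpos h]; simp
  · rw [Int.toNat_of_nonpos (z := -m i) (by omega)]; simp

theorem commute_monoOp_zero (c d : (ι → ℤ) → F) : Commute (monoOp c 0) (monoOp d 0) :=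
  monoOp_comm fun m => by rw [add_zero, mul_comm]

section

variable [Fintype ι]

/-- Multiplication by `π x_i ∂_i W_A`. -/
def phiZ {F : Type} [Field F] {ι : Type} [Fintype ι] (π : F) (A : Matrix ι ι ℕ) (i : ι) :
    End F ((ι → ℤ) →₀ F) :=
  π • ∑ l, (A l i : F) • rowZ F A l

theorem Commute.phiZ_left {f : End F ((ι → ℤ) →₀ F)} (π : F) (A : Matrix ι ι ℕ) (i : ι)
    (h : ∀ l, Commute (rowZ F A l) f) : Commute (phiZ π A i) f :=
  (Commute.sum_left _ _ _ fun l _ => (h l).smul_left _).smul_left _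

theorem thetaZ_mul_phiZ (π : F) (A : Matrix ι ι ℕ) (i j : ι) :
    thetaZ F i * phiZ π A j = phiZ π A j * thetaZ F i +
      π • ∑ l, ((A l i : F) * A l j) • rowZ F A l := by
  simp only [phiZ, mul_smul_comm, smul_mul_assoc, Finset.mul_sum, Finset.sum_mul, thetaZ_mul_rowZ,
    smul_add, Finset.sum_add_distrib, smul_smul]
  simp only [mul_comm]

theorem phiZ_mul_eq_zero (π : F) (A : Matrix ι ι ℕ) (i : ι) (d : (ι → ℤ) → F) (s : ι → ℤ)
    (hd : ∀ m, d m ≠ 0 → m i + s i < 0) : phiZ π A i * monoOp d s = 0 := by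
  simp only [phiZ, smul_mul_assoc, Finset.sum_mul, rowZ_mul_eq_zero A i _ d s hd,
    Finset.sum_const_zero, smul_zero]

theorem phiZ_mul_tdualZ (π ρ : F) (A : Matrix ι ι ℕ) (i : ι) :
    phiZ π A i * tdualZ ρ i = 0 := by
  refine phiZ_mul_eq_zero π A i _ _ fun m hm => ?_
  by_contra h
  refine hm ?_
  simp only [Pi.zero_apply, add_zero, not_lt] at h
  rw [Int.toNat_of_nonpos (by omega)]
  simp

theorem commute_phiZ_phiZ (π : F) (A : Matrix ι ι ℕ) (i j : ι) :
    Commute (phiZ π A i) (phiZ π A j) :=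
  Commute.phiZ_left π A i fun l => (Commute.phiZ_left π A j fun l' =>
    commute_rowZ_rowZ A l' l).symm

theorem commute_phiZ_tdualZ (π ρ : F) (A : Matrix ι ι ℕ) (i j : ι) :
    Commute (phiZ π A i) (tdualZ ρ j) :=
  Commute.phiZ_left π A i fun l => (commute_tdualZ_rowZ ρ A j l).symm

end

variable [LinearOrder ι]

/-- Multiplication by `z_i`. -/
def psiZ (F : Type) [Field F] {ι : Type} [LinearOrder ι] (i : ι) : End F ((ι → ℤ) →₀ F) :=
  monoOp (fun m => if m i ≤ 0 then 1 else 0) (-Pi.single i 1)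

/-- Division by `z_i`. -/
def sigmaZ (F : Type) [Field F] {ι : Type} [LinearOrder ι] (i : ι) : End F ((ι → ℤ) →₀ F) :=
  monoOp (fun m => if m i < 0 then 1 else 0) (Pi.single i 1)

theorem commute_psiZ_psiZ (i j : ι) : Commute (psiZ F i) (psiZ F j) := by
  by_cases hij : i = j
  · rw [hij]
  · refine monoOp_comm fun m => ?_
    simp only [Pi.add_apply, Pi.neg_apply, Pi.single_eq_of_ne hij, Pi.single_eq_of_ne (Ne.symm hij)]
    simp [mul_comm]

theorem commute_rowZ_psiZ (A : Matrix ι ι ℕ) (l j : ι) :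
    Commute (rowZ F A l) (psiZ F j) := by
  refine monoOp_comm fun m => ?_
  have h : (m j ≤ 0 ∧ ∀ k, 0 < A l k → 0 ≤ m k + -(Pi.single j 1 : ι → ℤ) k) ↔
      ((∀ k, 0 < A l k → 0 ≤ m k) ∧ m j + A l j ≤ 0) := by
    constructor
    · rintro ⟨h1, h2⟩
      have hj := h2 j
      rw [Pi.single_eq_same] at hj
      refine ⟨fun k hk => ?_, by omega⟩
      by_cases hkj : k = j
      · subst hkj; omega
      · simpa [hkj] using h2 k hk
    · rintro ⟨h1, h2⟩
      have hj := h1 j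
      refine ⟨by omega, fun k hk => ?_⟩
      by_cases hkj : k = j
      · subst hkj; omega
      · simpa [hkj] using h1 k hk
  simp only [Pi.add_apply, Pi.neg_apply, mul_ite, mul_one, mul_zero, ← ite_and]
  simp only [and_comm] at h ⊢
  simp only [h]

theorem commute_thetaZ_psiZ (i j : ι) : Commute (thetaZ F i) (psiZ F j) := by
  refine monoOp_comm fun m => ?_
  simp only [Pi.add_apply, Pi.neg_apply, Pi.zero_apply, add_zero]
  by_cases hij : i = j
  · subst hij
    simp only [Pi.single_eq_same]
    split_ifs with h
    · rw [Int.toNat_of_nonpos h, Int.toNat_of_nonpos (by omega)]; simp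
    · simp
  · simp [Pi.single_eq_of_ne hij]

theorem commute_tdualZ_psiZ (ρ : F) {i j : ι} (hij : i ≠ j) :
    Commute (tdualZ ρ i) (psiZ F j) := by
  refine monoOp_comm fun m => ?_
  simp only [Pi.add_apply, Pi.neg_apply, Pi.zero_apply, add_zero, Pi.single_eq_of_ne hij]
  simp [mul_comm]

theorem thetaZ_mul_psiZ (i : ι) : thetaZ F i * psiZ F i = 0 := by
  refine monoOp_mul_eq_zero fun m => ?_
  simp only [Pi.add_apply, Pi.neg_apply, Pi.single_eq_same]
  split_ifs with h
  · rw [Int.toNat_of_nonpos (by omega)]; simp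
  · simp

variable [Fintype ι]

theorem phiZ_mul_psiZ (π : F) (A : Matrix ι ι ℕ) (i : ι) : phiZ π A i * psiZ F i = 0 := by
  refine phiZ_mul_eq_zero π A i _ _ fun m hm => ?_
  have : m i ≤ 0 := by
    by_contra h
    simp [h] at hm
  simp only [Pi.neg_apply, Pi.single_eq_same]
  omega

theorem commute_phiZ_psiZ (π : F) (A : Matrix ι ι ℕ) (i j : ι) :
    Commute (phiZ π A i) (psiZ F j) :=
  Commute.phiZ_left π A i fun l => commute_rowZ_psiZ A l j

/-- The leading part of the differential. -/
def leadDiff (π : F) (A : Matrix ι ι ℕ) : End F (Finset ι → (ι → ℤ) →₀ F) :=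
  cliffordDiff (phiZ π A) (psiZ F)

/-- The degree preserving part of the differential. -/
def eulerDiff (F : Type) [Field F] (ι : Type) [LinearOrder ι] [Fintype ι] (ρ : F) :
    End F (Finset ι → (ι → ℤ) →₀ F) :=
  cliffordDiff (thetaZ F) (tdualZ ρ)

theorem leadDiff_add_eulerDiff (π ρ : F) (A : Matrix ι ι ℕ) :
    leadDiff π A + eulerDiff F ι ρ =
      cliffordDiff (fun i => thetaZ F i + phiZ π A i) (fun i => tdualZ ρ i + psiZ F i) := by
  simp only [leadDiff, eulerDiff, cliffordDiff, raise_add, lower_add, ← Finset.sum_add_distrib]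
  refine Finset.sum_congr rfl fun i _ => ?_
  abel

theorem leadDiff_sq (π : F) (A : Matrix ι ι ℕ) : leadDiff π A * leadDiff π A = 0 :=
  cliffordDiff_sq _ _ (commute_phiZ_phiZ π A) commute_psiZ_psiZ (commute_phiZ_psiZ π A)
    (phiZ_mul_psiZ π A)

theorem totalDiff_sq (π ρ : F) (A : Matrix ι ι ℕ) :
    (leadDiff π A + eulerDiff F ι ρ) * (leadDiff π A + eulerDiff F ι ρ) = 0 := by
  rw [leadDiff_add_eulerDiff]
  refine cliffordDiff_sq _ _ (fun i j => ?_) (fun i j => ?_) (fun i j => ?_) fun i => ?_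
  · have h1 : thetaZ F i * thetaZ F j = thetaZ F j * thetaZ F i := commute_monoOp_zero _ _
    have h2 : phiZ π A i * phiZ π A j = phiZ π A j * phiZ π A i := commute_phiZ_phiZ π A i j
    rw [add_mul, mul_add, mul_add, add_mul, mul_add, mul_add, thetaZ_mul_phiZ, thetaZ_mul_phiZ,
      h1, h2]
    simp only [mul_comm (A _ i : F)]
    abel
  · by_cases hij : i = j
    · rw [hij]
    · exact ((commute_monoOp_zero _ _).add_left (commute_tdualZ_psiZ ρ (Ne.symm hij)).symm).add_right
        ((commute_tdualZ_psiZ ρ hij).add_left (commute_psiZ_psiZ i j))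
  · exact ((commute_monoOp_zero _ _).add_left (commute_phiZ_tdualZ π ρ A i j)).add_right
      ((commute_thetaZ_psiZ i j).add_left (commute_phiZ_psiZ π A i j))
  · rw [add_mul, mul_add, mul_add, thetaZ_mul_tdualZ, thetaZ_mul_psiZ, phiZ_mul_psiZ,
      phiZ_mul_tdualZ]
    simp

end MonomialModel

section Weights

open Module

variable {F ι : Type} [Field F]

theorem monoOp_single_mem_supported (c : (ι → ℤ) → F) (t m : ι → ℤ) {s : Set (ι → ℤ)}
    (h : c m ≠ 0 → m + t ∈ s) (a : F) :
    monoOp c t (Finsupp.single m a) ∈ Finsupp.supported F F s := by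
  rw [monoOp_single]
  by_cases hc : c m = 0
  · rw [hc, mul_zero, Finsupp.single_zero]
    exact Submodule.zero_mem _
  · exact Finsupp.single_mem_supported F _ (h hc)

variable [Fintype ι]

/-- The weight of `x^γ z^μ` when `x_j` has weight `q j` and `z_j` has weight `1`. -/
def expWeight (q : ι → ℚ) (m : ι → ℤ) : ℚ :=
  ∑ j, (q j * (m j).toNat + (-m j).toNat)

theorem expWeight_nonneg {q : ι → ℚ} (hq : ∀ j, 0 ≤ q j) (m : ι → ℤ) : 0 ≤ expWeight q m :=
  Finset.sum_nonneg fun j _ => add_nonneg (mul_nonneg (hq j) (Nat.cast_nonneg _))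
    (Nat.cast_nonneg _)

variable [LinearOrder ι]

/-- The monomial basis of `F[x^γ z^μ] ⊗ ⋀(Fⁿ)`. -/
def monomialBasis (F ι : Type) [Field F] [Fintype ι] :
    Basis (Σ _ : Finset ι, ι → ℤ) F (Finset ι → (ι → ℤ) →₀ F) :=
  Pi.basis fun _ => Finsupp.basisSingleOne

theorem monomialBasis_apply (x : Σ _ : Finset ι, ι → ℤ) :
    monomialBasis F ι x = Pi.single x.1 (Finsupp.single x.2 1) := by
  rw [monomialBasis, Pi.basis_apply, Finsupp.coe_basisSingleOne]

theorem mem_weightSpace_of_forall_mem_supported (wt : (ι → ℤ) → ℚ) (c : ℚ)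
    {v : Finset ι → (ι → ℤ) →₀ F} (hv : ∀ S, v S ∈ Finsupp.supported F F {m | wt m = c}) :
    v ∈ weightSpace (monomialBasis F ι) (fun x => wt x.2) c := by
  rw [← Finset.univ_sum_single v]
  refine Submodule.sum_mem _ fun S _ => ?_
  have key : Finsupp.supported F F {m | wt m = c} ≤
      (weightSpace (monomialBasis F ι) (fun x => wt x.2) c).comap (LinearMap.single F _ S) := by
    rw [Finsupp.supported_eq_span_single, Submodule.span_le]
    rintro _ ⟨m, hm, rfl⟩
    refine Submodule.subset_span ⟨⟨S, m⟩, hm, ?_⟩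
    rw [monomialBasis_apply]
    rfl
  exact key (hv S)

theorem cliffordDiff_basis_mem_weightSpace (wt : (ι → ℤ) → ℚ) (e : ℚ)
    {f g : ι → End F ((ι → ℤ) →₀ F)}
    (hf : ∀ i m, f i (Finsupp.single m 1) ∈ Finsupp.supported F F {m' | wt m' = wt m + e})
    (hg : ∀ i m, g i (Finsupp.single m 1) ∈ Finsupp.supported F F {m' | wt m' = wt m + e})
    (x : Σ _ : Finset ι, ι → ℤ) : cliffordDiff f g (monomialBasis F ι x) ∈
      weightSpace (monomialBasis F ι) (fun x => wt x.2) (wt x.2 + e) := by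
  have key (h : End F ((ι → ℤ) →₀ F))
      (hh : ∀ m, h (Finsupp.single m 1) ∈ Finsupp.supported F F {m' | wt m' = wt m + e})
      (T : Finset ι) : h ((Pi.single x.1 (Finsupp.single x.2 1) : Finset ι → (ι → ℤ) →₀ F) T) ∈
        Finsupp.supported F F {m' | wt m' = wt x.2 + e} := by
    by_cases hT : T = x.1
    · subst hT
      rw [Pi.single_eq_same]
      exact hh x.2
    · rw [Pi.single_eq_of_ne hT, map_zero]
      exact Submodule.zero_mem _
  refine mem_weightSpace_of_forall_mem_supported wt _ fun S => ?_
  rw [monomialBasis_apply, cliffordDiff, LinearMap.sum_apply, Finset.sum_apply]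
  refine Submodule.sum_mem _ fun i _ => ?_
  rw [LinearMap.add_apply, Pi.add_apply, raise_apply, lower_apply]
  refine Submodule.add_mem _ ?_ ?_ <;> split_ifs
  · exact Submodule.smul_mem _ _ (key _ (hf i) _)
  · exact Submodule.zero_mem _
  · exact Submodule.zero_mem _
  · exact Submodule.smul_mem _ _ (key _ (hg i) _)

theorem eulerDiff_basis_mem_weightSpace (ρ : F) (q : ι → ℚ) (x : Σ _ : Finset ι, ι → ℤ) :
    eulerDiff F ι ρ (monomialBasis F ι x) ∈
      weightSpace (monomialBasis F ι) (fun x => expWeight q x.2) (expWeight q x.2 + 0) := by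
  refine cliffordDiff_basis_mem_weightSpace (expWeight q) 0 (fun i m => ?_) (fun i m => ?_) x <;>
  · refine monoOp_single_mem_supported _ _ _ (fun _ => ?_) _
    simp

theorem leadDiff_basis_mem_weightSpace (π : F) (A : Matrix ι ι ℕ) (q : ι → ℚ)
    (hq : ∀ l, ∑ j, (A l j : ℚ) * q j = 1) (x : Σ _ : Finset ι, ι → ℤ) :
    leadDiff π A (monomialBasis F ι x) ∈
      weightSpace (monomialBasis F ι) (fun x => expWeight q x.2) (expWeight q x.2 + 1) := by
  refine cliffordDiff_basis_mem_weightSpace (expWeight q) 1 (fun i m => ?_) (fun i m => ?_) x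
  · rw [phiZ, LinearMap.smul_apply, LinearMap.sum_apply]
    refine Submodule.smul_mem _ _ (Submodule.sum_mem _ fun l _ => Submodule.smul_mem _ _ ?_)
    refine monoOp_single_mem_supported _ _ _ (fun h => ?_) _
    have hm : ∀ j, 0 < A l j → 0 ≤ m j := by
      by_contra h'
      exact h (if_neg h')
    rw [Set.mem_ofPred_eq, expWeight, expWeight, ← hq l, ← Finset.sum_add_distrib]
    refine Finset.sum_congr rfl fun j _ => ?_
    have h1 : (m j + A l j).toNat = (m j).toNat + A l j := by have := hm j; omega
    have h2 : (-(m j + A l j)).toNat = (-m j).toNat := by have := hm j; omega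
    rw [Pi.add_apply, h1, h2]
    push_cast
    ring
  · refine monoOp_single_mem_supported _ _ _ (fun h => ?_) _
    have hm : m i ≤ 0 := by
      by_contra h'
      exact h (if_neg h')
    rw [Set.mem_ofPred_eq, expWeight, expWeight, ← Finset.add_sum_erase _ _ (Finset.mem_univ i),
      ← Finset.add_sum_erase (a := i) _ _ (Finset.mem_univ i)]
    have h1 : ((m + -Pi.single i 1 : ι → ℤ) i).toNat = (m i).toNat := by
      simp only [Pi.add_apply, Pi.neg_apply, Pi.single_eq_same]; omega
    have h2 : (-(m + -Pi.single i 1 : ι → ℤ) i).toNat = (-m i).toNat + 1 := by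
      simp only [Pi.add_apply, Pi.neg_apply, Pi.single_eq_same]; omega
    have h3 : ∀ j ∈ Finset.univ.erase i, q j * ((m + -Pi.single i 1 : ι → ℤ) j).toNat +
        ((-(m + -Pi.single i 1 : ι → ℤ) j).toNat : ℚ) = q j * (m j).toNat + (-m j).toNat := by
      intro j hj
      have : (m + -Pi.single i 1 : ι → ℤ) j = m j := by
        simp [Pi.single_eq_of_ne (Finset.ne_of_mem_erase hj)]
      rw [this]
    rw [h1, h2, Finset.sum_congr rfl h3]
    push_cast
    ring

end Weights

section Retract

open Module

variable {F ι : Type} [Field F]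

theorem map_mem_supported (f : End F ((ι → ℤ) →₀ F)) {s t : Set (ι → ℤ)}
    (hf : ∀ m ∈ s, f (Finsupp.single m 1) ∈ Finsupp.supported F F t)
    {x : (ι → ℤ) →₀ F} (hx : x ∈ Finsupp.supported F F s) :
    f x ∈ Finsupp.supported F F t := by
  have : Finsupp.supported F F s ≤ (Finsupp.supported F F t).comap f := by
    rw [Finsupp.supported_eq_span_single, Submodule.span_le]
    rintro _ ⟨m, hm, rfl⟩
    exact hf m hm
  exact this hx

/-- The exponents `m` such that, for all `j ∈ U`, `x^γ z^μ` is free of `z_j`, and is divisible by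
`x_j` if `j ∈ S`. -/
def regularExps (U S : Finset ι) : Set (ι → ℤ) :=
  {m | ∀ j ∈ U, 0 ≤ m j ∧ (j ∈ S → 0 < m j)}

/-- The span of the `x^γ z^μ ⊗ e_S` with exponent in `regularExps U S`. -/
def regularSub (F : Type) {ι : Type} [Field F] (U : Finset ι) :
    Submodule F (Finset ι → (ι → ℤ) →₀ F) :=
  Submodule.pi Set.univ fun S => Finsupp.supported F F (regularExps U S)

theorem mem_regularSub {U : Finset ι} {v : Finset ι → (ι → ℤ) →₀ F} :
    v ∈ regularSub F U ↔ ∀ S, v S ∈ Finsupp.supported F F (regularExps U S) := by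
  simp [regularSub, Submodule.mem_pi]

variable [LinearOrder ι]

theorem commute_psiZ_sigmaZ {i k : ι} (hik : i ≠ k) : Commute (psiZ F i) (sigmaZ F k) := by
  refine monoOp_comm fun m => ?_
  simp only [Pi.add_apply, Pi.neg_apply, Pi.single_eq_of_ne hik, Pi.single_eq_of_ne hik.symm]
  simp [mul_comm]

theorem rowZ_sigmaZ_mem_supported (A : Matrix ι ι ℕ) {i k l : ι} (hik : i ≠ k) {U S : Finset ι}
    (hi : i ∈ S) (hk : k ∉ U) (hl : A l i ≠ 0) {m : ι → ℤ}
    (hm : m ∈ regularExps U ((S.erase i).erase k)) :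
    (rowZ F A l * sigmaZ F k - sigmaZ F k * rowZ F A l) (Finsupp.single m 1) ∈
      Finsupp.supported F F (regularExps (insert k U) S) := by
  by_cases hlk : A l k = 0
  · have : Commute (rowZ F A l) (sigmaZ F k) := by
      refine monoOp_comm fun m => ?_
      have h : (∀ j, 0 < A l j → 0 ≤ m j + (Pi.single k 1 : ι → ℤ) j) ↔
          ∀ j, 0 < A l j → 0 ≤ m j := by
        refine forall_congr' fun j => imp_congr_right fun hj => ?_
        rw [Pi.single_eq_of_ne (by rintro rfl; omega), add_zero]
      simp only [Pi.add_apply, h, hlk, Nat.cast_zero, add_zero]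
      exact mul_comm _ _
    rw [LinearMap.sub_apply, this.eq, sub_self]
    exact Submodule.zero_mem _
  · have : sigmaZ F k * rowZ F A l = 0 := by
      refine monoOp_mul_eq_zero fun m => ?_
      simp only [Pi.add_apply]
      split_ifs with h1 h2
      · have := h1 k (Nat.pos_of_ne_zero hlk)
        omega
      all_goals simp
    rw [LinearMap.sub_apply, this, LinearMap.zero_apply, sub_zero, rowZ, sigmaZ, monoOp_mul]
    refine monoOp_single_mem_supported _ _ _ (fun h => ?_) _
    have h1 : m k < 0 := by
      by_contra h'
      simp [h'] at h
    have h2 : ∀ j, 0 < A l j → 0 ≤ (m + Pi.single k 1 : ι → ℤ) j := by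
      by_contra h'
      exact h (by rw [if_neg h', mul_zero])
    intro j hj
    by_cases hjk : j = k
    · subst hjk
      have := h2 j (Nat.pos_of_ne_zero hlk)
      simp only [Pi.add_apply, Pi.single_eq_same] at this ⊢
      omega
    · have h3 := hm j ((Finset.mem_insert.1 hj).resolve_left hjk)
      have h4 := h2 j
      simp only [Pi.add_apply, Pi.single_eq_of_ne hjk, Finset.mem_erase, ne_eq, hjk,
        not_false_eq_true, true_and, add_zero] at h3 h4 ⊢
      refine ⟨by omega, fun hjS => ?_⟩
      by_cases hji : j = i
      · subst hji
        omega
      · have := h3.2 ⟨hji, hjS⟩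
        omega

theorem psiZ_sigmaZ_single (k : ι) (m : ι → ℤ) :
    (psiZ F k * sigmaZ F k) (Finsupp.single m 1) = if m k < 0 then Finsupp.single m 1 else 0 := by
  rw [psiZ, sigmaZ, monoOp_mul, monoOp_single]
  simp only [Pi.add_apply, Pi.single_eq_same, neg_add_cancel, add_zero, one_mul]
  split_ifs with h1 h2
  · simp
  · omega
  · simp
  · simp

theorem sigmaZ_psiZ_single (k : ι) (m : ι → ℤ) :
    (sigmaZ F k * psiZ F k) (Finsupp.single m 1) = if m k ≤ 0 then Finsupp.single m 1 else 0 := by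
  rw [psiZ, sigmaZ, monoOp_mul, monoOp_single]
  simp only [Pi.add_apply, Pi.neg_apply, Pi.single_eq_same, add_neg_cancel, add_zero, one_mul]
  split_ifs with h1 h2
  · simp
  · omega
  · simp
  · simp

variable [Fintype ι]

theorem phiZ_sigmaZ_mem_supported (π : F) (A : Matrix ι ι ℕ) {i k : ι} (hik : i ≠ k)
    {U S : Finset ι} (hi : i ∈ S) (hk : k ∉ U) {x : (ι → ℤ) →₀ F}
    (hx : x ∈ Finsupp.supported F F (regularExps U ((S.erase i).erase k))) :
    (phiZ π A i * sigmaZ F k - sigmaZ F k * phiZ π A i) x ∈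
      Finsupp.supported F F (regularExps (insert k U) S) := by
  refine map_mem_supported _ (fun m hm => ?_) hx
  have h1 : phiZ π A i * sigmaZ F k = π • ∑ l, (A l i : F) • (rowZ F A l * sigmaZ F k) := by
    simp only [phiZ, smul_mul_assoc, Finset.sum_mul]
  have h2 : sigmaZ F k * phiZ π A i = π • ∑ l, (A l i : F) • (sigmaZ F k * rowZ F A l) := by
    simp only [phiZ, mul_smul_comm, Finset.mul_sum]
  simp only [h1, h2, LinearMap.sub_apply, LinearMap.smul_apply, LinearMap.sum_apply]
  simp only [← smul_sub, ← Finset.sum_sub_distrib]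
  refine Submodule.smul_mem _ _ (Submodule.sum_mem _ fun l _ => ?_)
  by_cases hl : A l i = 0
  · rw [hl, Nat.cast_zero, zero_smul]
    exact Submodule.zero_mem _
  · exact Submodule.smul_mem _ _ (rowZ_sigmaZ_mem_supported A hik hi hk hl hm)

theorem sub_homotopy_mem_regularSub (π : F) (A : Matrix ι ι ℕ) {k : ι} {U : Finset ι}
    (hk : k ∉ U) {u : Finset ι → (ι → ℤ) →₀ F} (hu : u ∈ regularSub F U) :
    u - (leadDiff π A * raise k (sigmaZ F k) + raise k (sigmaZ F k) * leadDiff π A) u ∈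
      regularSub F (insert k U) := by
  rw [mem_regularSub] at hu ⊢
  intro S
  have hsum : leadDiff π A * raise k (sigmaZ F k) + raise k (sigmaZ F k) * leadDiff π A =
      (raise k (sigmaZ F k) * lower k (psiZ F k) + lower k (psiZ F k) * raise k (sigmaZ F k)) +
      ∑ i ∈ Finset.univ.erase k, (raise i (phiZ π A i) * raise k (sigmaZ F k) +
        raise k (sigmaZ F k) * raise i (phiZ π A i)) := by
    rw [leadDiff, cliffordDiff, Finset.sum_mul, Finset.mul_sum, ← Finset.sum_add_distrib,
      ← Finset.add_sum_erase _ _ (Finset.mem_univ k)]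
    refine congrArg₂ (· + ·) ?_ ?_
    · rw [add_mul, mul_add, raise_mul_self, raise_mul_self, zero_add, zero_add, add_comm]
    · refine Finset.sum_congr rfl fun i hi => ?_
      have hik := Finset.ne_of_mem_erase hi
      have := raise_lower_anticomm (M := (ι → ℤ) →₀ F) hik.symm
        (commute_psiZ_sigmaZ (F := F) hik).symm.eq
      rw [add_mul, mul_add, add_add_add_comm, add_comm (lower i _ * _), this, add_zero]
  rw [hsum, LinearMap.add_apply, LinearMap.sum_apply, ← sub_sub, Pi.sub_apply, Finset.sum_apply,
    Pi.sub_apply, raise_lower_self_apply]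
  refine Submodule.sub_mem _ ?_ (Submodule.sum_mem _ fun i hi => ?_)
  · have key : (LinearMap.id - if k ∈ S then sigmaZ F k * psiZ F k else psiZ F k * sigmaZ F k :
        End F ((ι → ℤ) →₀ F)) (u S) ∈ Finsupp.supported F F (regularExps (insert k U) S) := by
      refine map_mem_supported _ (fun m hm => ?_) (hu S)
      have h1 : (0 ≤ m k ∧ (k ∈ S → 0 < m k)) → m ∈ regularExps (insert k U) S := by
        intro h j hj
        rcases Finset.mem_insert.1 hj with rfl | hj
        · exact h
        · exact hm j hj
      rw [LinearMap.sub_apply]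
      split_ifs with hkS
      · rw [sigmaZ_psiZ_single]
        split_ifs with h
        · simp
        · exact Submodule.sub_mem _ (Finsupp.single_mem_supported F _ (h1 (by omega)))
            (Submodule.zero_mem _)
      · rw [psiZ_sigmaZ_single]
        split_ifs with h
        · simp
        · exact Submodule.sub_mem _ (Finsupp.single_mem_supported F _
            (h1 ⟨by omega, fun h' => absurd h' hkS⟩)) (Submodule.zero_mem _)
    split_ifs at key ⊢ <;> exact key
  · have hik := Finset.ne_of_mem_erase hi
    rw [raise_raise_apply hik]
    split_ifs with h
    · exact Submodule.smul_mem _ _ (phiZ_sigmaZ_mem_supported π A hik h.1 hk (hu _))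
    · exact Submodule.zero_mem _

theorem raise_sigmaZ_eq_zero (k : ι) {v : Finset ι → (ι → ℤ) →₀ F}
    (hv : v ∈ regularSub F Finset.univ) : raise k (sigmaZ F k) v = 0 := by
  funext S
  rw [raise_apply]
  split_ifs with h
  · have := map_mem_supported (sigmaZ F k) (t := ∅) (fun m hm => ?_)
      (mem_regularSub.1 hv (S.erase k))
    · rw [Finsupp.supported_empty, Submodule.mem_bot] at this
      rw [this, smul_zero, Pi.zero_apply]
    · refine monoOp_single_mem_supported _ _ _ (fun h => ?_) _
      rw [if_neg (not_lt.2 (hm k (Finset.mem_univ k)).1)] at h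
      exact (h rfl).elim
  · rfl

/-- Every element whose leading differential lies in `regularSub F univ` can be moved to
`regularSub F univ` by a boundary. -/
theorem exists_mem_regularSub (π : F) (A : Matrix ι ι ℕ) {v : Finset ι → (ι → ℤ) →₀ F}
    (hv : leadDiff π A v ∈ regularSub F Finset.univ) :
    ∃ v' ∈ regularSub F Finset.univ, ∃ y, v = v' + leadDiff π A y := by
  have key (U : Finset ι) : ∃ v' ∈ regularSub F U, ∃ y, v = v' + leadDiff π A y := by
    induction U using Finset.induction with
    | empty =>
      refine ⟨v, mem_regularSub.2 fun S => ?_, 0, by simp⟩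
      simp [regularExps, Finsupp.supported_univ]
    | insert k U hk ih =>
      obtain ⟨v', hv', y, hy⟩ := ih
      have h1 : leadDiff π A v' = leadDiff π A v := by
        rw [hy, map_add, ← Module.End.mul_apply, leadDiff_sq]
        simp
      have h2 := sub_homotopy_mem_regularSub π A hk hv'
      rw [LinearMap.add_apply, Module.End.mul_apply, Module.End.mul_apply, h1,
        raise_sigmaZ_eq_zero k hv, add_zero] at h2
      refine ⟨_, h2, y + raise k (sigmaZ F k) v', ?_⟩
      rw [map_add, hy]
      abel
  exact key Finset.univ

end Retract

section DeRham

open Module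

variable {F ι : Type} [Field F]

/-- The exponent of `x^d ∏_{j ∈ S} x_j`. -/
def shiftExp (S : Finset ι) (d : ι →₀ ℕ) : ι → ℤ :=
  fun j => d j + if j ∈ S then 1 else 0

theorem shiftExp_injective (S : Finset ι) : Function.Injective (shiftExp S) := by
  intro d d' h
  ext j
  have := congrFun h j
  simp only [shiftExp] at this
  omega

/-- The linear map `x^d ↦ x^d ∏_{j ∈ S} x_j`. -/
def shiftEmbed (F : Type) {ι : Type} [Field F] (S : Finset ι) :
    MvPolynomial ι F →ₗ[F] (ι → ℤ) →₀ F :=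
  Finsupp.lmapDomain F F (shiftExp S) ∘ₗ (MvPolynomial.basisMonomials ι F).repr

theorem shiftEmbed_monomial (S : Finset ι) (d : ι →₀ ℕ) (a : F) :
    shiftEmbed F S (MvPolynomial.monomial d a) = Finsupp.single (shiftExp S d) a := by
  have : MvPolynomial.monomial d a = a • MvPolynomial.basisMonomials ι F d := by
    simp [MvPolynomial.smul_monomial]
  rw [this, map_smul, shiftEmbed, LinearMap.comp_apply, LinearEquiv.coe_coe, Basis.repr_self]
  simp

theorem shiftEmbed_injective (S : Finset ι) : Function.Injective (shiftEmbed F S) :=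
  (Finsupp.mapDomain_injective (shiftExp_injective S)).comp
    (MvPolynomial.basisMonomials ι F).repr.injective

/-- The inclusion of the (logarithmic) de Rham complex, `x^d ⊗ e_S ↦ x^d ∏_{j ∈ S} x_j ⊗ e_S`. -/
def deRhamEmbed (F ι : Type) [Field F] :
    (Finset ι → MvPolynomial ι F) →ₗ[F] Finset ι → (ι → ℤ) →₀ F :=
  LinearMap.pi fun S => shiftEmbed F S ∘ₗ LinearMap.proj S

theorem deRhamEmbed_apply (v : Finset ι → MvPolynomial ι F) (S : Finset ι) :
    deRhamEmbed F ι v S = shiftEmbed F S (v S) := rfl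

theorem deRhamEmbed_injective : Function.Injective (deRhamEmbed F ι) := fun _ _ h =>
  funext fun S => shiftEmbed_injective S (congrFun h S)

section

variable [Fintype ι]

theorem range_shiftExp (S : Finset ι) : Set.range (shiftExp S) = regularExps Finset.univ S := by
  ext m
  constructor
  · rintro ⟨d, rfl⟩ j -
    simp only [shiftExp]
    split_ifs with h <;> constructor <;> intros <;> first | omega | contradiction
  · intro hm
    refine ⟨Finsupp.equivFunOnFinite.symm fun j => (m j - if j ∈ S then 1 else 0).toNat, ?_⟩
    funext j
    have := hm j (Finset.mem_univ j)
    simp only [shiftExp, Finsupp.equivFunOnFinite_symm_apply_apply]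
    split_ifs with h
    · have := this.2 h
      omega
    · omega

theorem mem_range_deRhamEmbed {v : Finset ι → (ι → ℤ) →₀ F}
    (hv : v ∈ regularSub F Finset.univ) : v ∈ LinearMap.range (deRhamEmbed F ι) := by
  have h (S : Finset ι) : ∃ f, shiftEmbed F S f = v S := by
    have h1 := mem_regularSub.1 hv S
    rw [← range_shiftExp, ← Set.image_univ, ← Finsupp.lmapDomain_supported] at h1
    obtain ⟨g, -, hg⟩ := h1
    exact ⟨(MvPolynomial.basisMonomials ι F).repr.symm g, by
      rwa [shiftEmbed, LinearMap.comp_apply, LinearEquiv.coe_coe, LinearEquiv.apply_symm_apply]⟩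
  choose f hf using h
  exact ⟨f, funext hf⟩

theorem deRhamEmbed_mem_regularSub (v : Finset ι → MvPolynomial ι F) :
    deRhamEmbed F ι v ∈ regularSub F Finset.univ := by
  refine mem_regularSub.2 fun S => ?_
  rw [← range_shiftExp, ← Set.image_univ, ← Finsupp.lmapDomain_supported]
  exact ⟨_, by simp, rfl⟩

theorem Wpoly_eq_sum_monomial (A : Matrix ι ι ℕ) :
    Wpoly F A = ∑ l, MvPolynomial.monomial (Finsupp.equivFunOnFinite.symm (A l)) 1 := by
  refine Finset.sum_congr rfl fun l _ => ?_
  rw [MvPolynomial.monomial_eq, map_one, one_mul, Finsupp.prod_fintype _ _ fun _ => pow_zero _]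
  rfl

end

theorem tdualZ_shiftEmbed (ρ : F) (i : ι) (S : Finset ι) (f : MvPolynomial ι F) :
    tdualZ ρ i (shiftEmbed F S f) = 0 := by
  have : tdualZ ρ i ∘ₗ shiftEmbed F S = 0 := by
    refine MvPolynomial.linearMap_ext fun d => LinearMap.ext fun a => ?_
    have h : (-shiftExp S d i).toNat = 0 := by
      simp only [shiftExp]
      split_ifs <;> omega
    simp [tdualZ, shiftEmbed_monomial, monoOp_single, h]
  exact LinearMap.congr_fun this f

variable [LinearOrder ι]

theorem psiZ_shiftEmbed {i : ι} {S : Finset ι} (hi : i ∈ S) (f : MvPolynomial ι F) :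
    psiZ F i (shiftEmbed F S f) = 0 := by
  have : psiZ F i ∘ₗ shiftEmbed F S = 0 := by
    refine MvPolynomial.linearMap_ext fun d => LinearMap.ext fun a => ?_
    have h : ¬ shiftExp S d i ≤ 0 := by
      simp only [shiftExp, hi, if_true]
      omega
    simp [psiZ, shiftEmbed_monomial, monoOp_single, h]
  exact LinearMap.congr_fun this f

variable [Fintype ι]

theorem phiZ_shiftEmbed (π : F) (A : Matrix ι ι ℕ) {i : ι} {S : Finset ι} (hi : i ∈ S)
    (f : MvPolynomial ι F) : phiZ π A i (shiftEmbed F (S.erase i) f) =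
      π • shiftEmbed F S (MvPolynomial.pderiv i (Wpoly F A) * f) := by
  have : phiZ π A i ∘ₗ shiftEmbed F (S.erase i) =
      π • shiftEmbed F S ∘ₗ LinearMap.mulLeft F (MvPolynomial.pderiv i (Wpoly F A)) := by
    refine MvPolynomial.linearMap_ext fun d => LinearMap.ext fun a => ?_
    simp only [LinearMap.comp_apply, LinearMap.smul_apply, LinearMap.mulLeft_apply, phiZ,
      LinearMap.sum_apply, Wpoly_eq_sum_monomial, map_sum, Finset.sum_mul, shiftEmbed_monomial,
      MvPolynomial.pderiv_monomial, MvPolynomial.monomial_mul, one_mul]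
    refine congrArg (π • ·) (Finset.sum_congr rfl fun l _ => ?_)
    rw [rowZ, monoOp_single, if_pos, Finsupp.smul_single, mul_one, smul_eq_mul]
    · by_cases hl : A l i = 0
      · simp [hl]
      · congr 1
        funext j
        simp only [Pi.add_apply, shiftExp, Finset.mem_erase, Finsupp.add_apply,
          Finsupp.tsub_apply, Finsupp.equivFunOnFinite_symm_apply_apply]
        by_cases hj : j = i
        · subst hj
          simp only [ne_eq, not_true, false_and, if_false, hi, if_true, Finsupp.single_eq_same]
          omega
        · simp only [ne_eq, hj, not_false_eq_true, true_and, Finsupp.single_eq_of_ne hj]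
          split_ifs <;> omega
    · intro j _
      simp only [shiftExp]
      split_ifs <;> omega
  exact LinearMap.congr_fun this f

theorem leadDiff_deRhamEmbed (π : F) (A : Matrix ι ι ℕ) (v : Finset ι → MvPolynomial ι F) :
    leadDiff π A (deRhamEmbed F ι v) = deRhamEmbed F ι
      (π • koszulDiff F (fun i => MvPolynomial.pderiv i (Wpoly F A)) Finset.univ v) := by
  funext S
  rw [deRhamEmbed_apply, Pi.smul_apply, map_smul, koszulDiff_apply, map_sum, Finset.smul_sum,
    leadDiff, cliffordDiff, LinearMap.sum_apply, Finset.sum_apply]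
  refine Finset.sum_congr rfl fun i _ => ?_
  rw [LinearMap.add_apply, Pi.add_apply, raise_apply, lower_apply]
  split_ifs with h
  · rw [deRhamEmbed_apply, phiZ_shiftEmbed π A h, add_zero, map_smul, smul_comm]
  · rw [deRhamEmbed_apply, psiZ_shiftEmbed (Finset.mem_insert_self i S)]
    simp

/-- The top forms `f x_1 ⋯ x_n ⊗ e_1 ∧ ⋯ ∧ e_n`. -/
def topForm (F ι : Type) [Field F] [LinearOrder ι] [Fintype ι] :
    MvPolynomial ι F →ₗ[F] Finset ι → (ι → ℤ) →₀ F :=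
  deRhamEmbed F ι ∘ₗ LinearMap.single F (fun _ => MvPolynomial ι F) Finset.univ

theorem eulerDiff_topForm (ρ : F) (f : MvPolynomial ι F) :
    eulerDiff F ι ρ (topForm F ι f) = 0 := by
  funext S
  rw [eulerDiff, cliffordDiff, LinearMap.sum_apply, Finset.sum_apply]
  refine Finset.sum_eq_zero fun i _ => ?_
  have h : S.erase i ≠ Finset.univ := fun h =>
      Finset.notMem_erase i S (h.symm ▸ Finset.mem_univ i)
  rw [LinearMap.add_apply, Pi.add_apply, raise_apply, lower_apply, topForm, LinearMap.comp_apply,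
    deRhamEmbed_apply, deRhamEmbed_apply, tdualZ_shiftEmbed, LinearMap.single_apply,
    Pi.single_eq_of_ne h]
  simp

theorem leadDiff_topForm (π : F) (A : Matrix ι ι ℕ) (f : MvPolynomial ι F) :
    leadDiff π A (topForm F ι f) = 0 := by
  have : koszulDiff F (fun i => MvPolynomial.pderiv i (Wpoly F A)) Finset.univ
      (Pi.single Finset.univ f) = 0 := by
    funext S
    rw [koszulDiff_apply]
    refine Finset.sum_eq_zero fun i _ => ?_
    have h : S.erase i ≠ Finset.univ := fun h =>
      Finset.notMem_erase i S (h.symm ▸ Finset.mem_univ i)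
    rw [Pi.single_eq_of_ne h]
    simp
  rw [topForm, LinearMap.comp_apply, leadDiff_deRhamEmbed, LinearMap.single_apply, this]
  simp

theorem topForm_mem_range_leadDiff {π : F} (hπ : π ≠ 0) (A : Matrix ι ι ℕ)
    (f : MvPolynomial ι F) : topForm F ι f ∈ LinearMap.range (leadDiff π A) ↔
      f ∈ Ideal.span (Set.range fun i => MvPolynomial.pderiv i (Wpoly F A)) := by
  rw [← Set.image_univ, ← Finset.coe_univ]
  constructor
  · rintro ⟨v, hv⟩
    obtain ⟨v', hv', y, hy⟩ := exists_mem_regularSub π A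
      (v := v) (hv ▸ deRhamEmbed_mem_regularSub _)
    obtain ⟨w, rfl⟩ := mem_range_deRhamEmbed hv'
    rw [hy, map_add, ← Module.End.mul_apply, leadDiff_sq, LinearMap.zero_apply, add_zero,
      leadDiff_deRhamEmbed] at hv
    have := congrFun (deRhamEmbed_injective hv) Finset.univ
    rw [LinearMap.single_apply, Pi.single_eq_same, Pi.smul_apply] at this
    rw [← this, Algebra.smul_def]
    exact Ideal.mul_mem_left _ _ (koszulDiff_apply_mem_span _ _ _ _)
  · intro hf
    obtain ⟨w, -, hw⟩ := exists_koszulDiff_eq_single (F := F) _ _ hf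
    refine ⟨π⁻¹ • deRhamEmbed F ι w, ?_⟩
    rw [map_smul, leadDiff_deRhamEmbed, hw, map_smul, smul_smul, inv_mul_cancel₀ hπ, one_smul]
    rfl

theorem ker_leadDiff_le {π : F} (hπ : π ≠ 0) (A : Matrix ι ι ℕ)
    (reg : ∀ i r, MvPolynomial.pderiv i (Wpoly F A) * r ∈
        Ideal.span ((fun i => MvPolynomial.pderiv i (Wpoly F A)) '' {j | j < i}) →
      r ∈ Ideal.span ((fun i => MvPolynomial.pderiv i (Wpoly F A)) '' {j | j < i})) :
    LinearMap.ker (leadDiff π A) ≤ LinearMap.range (leadDiff π A) ⊔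
      LinearMap.range (topForm F ι) := by
  intro v hv
  rw [LinearMap.mem_ker] at hv
  obtain ⟨v', hv', y, rfl⟩ := exists_mem_regularSub π A (hv ▸ Submodule.zero_mem _)
  obtain ⟨w, rfl⟩ := mem_range_deRhamEmbed hv'
  rw [map_add, ← Module.End.mul_apply, leadDiff_sq, LinearMap.zero_apply, add_zero,
    leadDiff_deRhamEmbed, map_eq_zero_iff _ deRhamEmbed_injective, smul_eq_zero_iff_right hπ] at hv
  obtain ⟨u, -, r, rfl⟩ := koszulDiff_exact (F := F) _ Finset.univ
    (fun i _ r => by simpa using reg i r) w (fun S hS => absurd (Finset.subset_univ S) hS) hv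
  refine Submodule.mem_sup.2 ⟨leadDiff π A (π⁻¹ • deRhamEmbed F ι u + y), ⟨_, rfl⟩,
    topForm F ι r, ⟨r, rfl⟩, ?_⟩
  rw [map_add, map_smul, leadDiff_deRhamEmbed, map_smul, smul_smul, inv_mul_cancel₀ hπ, one_smul,
    map_add, topForm, LinearMap.comp_apply, LinearMap.single_apply]
  abel

end DeRham

section Transport

open Module

variable {F ι : Type} [Field F] [Fintype ι]

/-- The row vector `μ Aᵀ`. -/
def mulTranspose (A : Matrix ι ι ℕ) (μ : ι → ℕ) : ι → ℕ :=
  fun j => ∑ k, μ k * A j k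

theorem cast_mulTranspose (R : Type) [CommRing R] (A : Matrix ι ι ℕ) (μ : ι → ℕ) :
    (fun j => (mulTranspose A μ j : R)) =
      Matrix.vecMul (fun k => (μ k : R)) (A.map ((↑) : ℕ → R))ᵀ := by
  funext j
  simp [mulTranspose, Matrix.vecMul, dotProduct]

variable [LinearOrder ι]

theorem cliffordDiff_compLeft {M N : Type} [AddCommGroup M] [Module F M] [AddCommGroup N]
    [Module F N] (r : M →ₗ[F] N) {f g : ι → End F M} {f' g' : ι → End F N}
    (hf : ∀ i x, f' i (r x) = r (f i x)) (hg : ∀ i x, g' i (r x) = r (g i x))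
    (v : Finset ι → M) : cliffordDiff f' g' (r.compLeft (Finset ι) v) =
      r.compLeft (Finset ι) (cliffordDiff f g v) := by
  funext S
  rw [LinearMap.compLeft_apply, Function.comp_apply]
  simp only [cliffordDiff, LinearMap.sum_apply, Finset.sum_apply, LinearMap.add_apply,
    Pi.add_apply, raise_apply, lower_apply, LinearMap.compLeft_apply, Function.comp_apply,
    map_sum, map_add, hf, hg]
  refine Finset.sum_congr rfl fun i _ => ?_
  split_ifs <;> simp

/-- The tensor factor `⋀(Fⁿ)` turned into functions on its basis. -/
def coordEquiv (F : Type) [Field F] {ι : Type} [Fintype ι] [LinearOrder ι] (A : Matrix ι ι ℕ) :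
    BMod F A ≃ₗ[F] (Finset ι → RMod F A) :=
  TensorProduct.piScalarRight F F (RMod F A) (Finset ι)

theorem coordEquiv_tmul (A : Matrix ι ι ℕ) (x : RMod F A) (f : ExtV F ι) (S : Finset ι) :
    coordEquiv F A (x ⊗ₜ f) S = f S • x := by
  rw [coordEquiv, TensorProduct.piScalarRight_apply, TensorProduct.piScalarRightHom_tmul]

theorem coordEquiv_DOp (π : F) (A : Matrix ι ι ℕ) (x : BMod F A) :
    coordEquiv F A (DOp F π A x) = cliffordDiff (fun i => thetaOp F A i + phiOp F π A i)
      (fun i => TdualOp F π A i + psidualOp F A i) (coordEquiv F A x) := by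
  induction x using TensorProduct.induction_on with
  | zero => simp
  | add x y hx hy => simp only [map_add, hx, hy]
  | tmul x f =>
    funext S
    simp only [DOp, dOp, dDualOp, LinearMap.add_apply, LinearMap.sum_apply, cliffordDiff,
      ← Finset.sum_add_distrib, map_sum, map_add, Finset.sum_apply, Pi.add_apply, dSingle,
      dDualSingle, TensorProduct.map_tmul, raise_apply, lower_apply, coordEquiv_tmul, mulE, contrE,
      LinearMap.coe_mk, AddHom.coe_mk, map_smul]
    refine Finset.sum_congr rfl fun i _ => ?_
    split_ifs <;> simp [extSign, mul_smul]

theorem exists_vecMul_inv_eq (π : F) (A : Matrix ι ι ℕ) :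
    ∃ ρ : F, ∀ (μ : ι → ℕ) (i : ι), π⁻¹ * Matrix.vecMul
      (fun k => (mulTranspose A μ k : F)) ((A.map ((↑) : ℕ → F))ᵀ)⁻¹ i = ρ * μ i := by
  by_cases h : IsUnit (A.map ((↑) : ℕ → F))ᵀ.det
  · refine ⟨π⁻¹, fun μ i => ?_⟩
    rw [cast_mulTranspose, Matrix.vecMul_vecMul, Matrix.mul_nonsing_inv _ h, Matrix.vecMul_one]
  · refine ⟨0, fun μ i => ?_⟩
    rw [Matrix.nonsing_inv_apply_not_isUnit _ h, Matrix.vecMul_zero]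
    simp

variable {A : Matrix ι ι ℕ}

theorem lamRow_mulTranspose (hA : (Aq A).det ≠ 0) (μ : ι → ℕ) (i : ι) :
    lamRow A (mulTranspose A μ) i = μ i := by
  rw [lamRow, cast_mulTranspose, Matrix.vecMul_vecMul, Aq, Matrix.mul_nonsing_inv,
    Matrix.vecMul_one]
  rw [Matrix.det_transpose]
  exact (isUnit_iff_ne_zero.2 hA)

theorem mulTranspose_injective (hA : (Aq A).det ≠ 0) : Function.Injective (mulTranspose A) := by
  intro μ ν h
  funext i
  have := lamRow_mulTranspose hA μ i
  rw [h, lamRow_mulTranspose hA] at this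
  exact_mod_cast this.symm

theorem OKA_mulTranspose (hA : (Aq A).det ≠ 0) (γ μ : ι → ℕ) :
    OKA A (γ, mulTranspose A μ) ↔ ∀ i, γ i = 0 ∨ μ i = 0 := by
  have h1 : (gamRow A γ ⬝ᵥ fun i => (mulTranspose A μ i : ℚ)) = ∑ i, (γ i : ℚ) * μ i := by
    rw [cast_mulTranspose, gamRow, Matrix.vecMul_transpose, Matrix.dotProduct_mulVec,
      Matrix.vecMul_vecMul, ← Aq, Matrix.nonsing_inv_mul _ (isUnit_iff_ne_zero.2 hA),
      Matrix.vecMul_one]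
    rfl
  rw [OKA, h1, Finset.sum_eq_zero_iff_of_nonneg fun i _ => by positivity]
  simp [lamRow_mulTranspose hA]

/-- The allowed monomial `x^γ y^{μAᵀ}` with `γ` and `μ` the positive and negative parts of `m`. -/
def okIdx (hA : (Aq A).det ≠ 0) (m : ι → ℤ) : {m : MonIdx ι // OKA A m} :=
  ⟨(fun i => (m i).toNat, mulTranspose A fun i => (-m i).toNat),
    (OKA_mulTranspose hA _ _).2 fun i => by omega⟩

theorem okIdx_injective (hA : (Aq A).det ≠ 0) : Function.Injective (okIdx hA) := by
  intro m m' h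
  have h1 := congrArg (fun x => x.1.1) h
  have h2 := mulTranspose_injective hA (congrArg (fun x => x.1.2) h)
  funext i
  have h3 := congrFun h1 i
  have h4 := congrFun h2 i
  simp only [okIdx] at h3
  omega

theorem bE_mulTranspose (F : Type) [Field F] (hA : (Aq A).det ≠ 0) (γ μ : ι → ℕ) :
    bE F A (γ, mulTranspose A μ) = if ∀ i, γ i = 0 ∨ μ i = 0 then
      Finsupp.single (okIdx hA fun i => (γ i : ℤ) - μ i) 1 else 0 := by
  rw [bE]
  by_cases h : ∀ i, γ i = 0 ∨ μ i = 0
  · rw [if_pos h, dif_pos ((OKA_mulTranspose hA _ _).2 h)]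
    congr 1
    refine Subtype.ext (Prod.ext ?_ (congrArg (mulTranspose A) ?_)) <;>
    · funext i
      have := h i
      simp only [okIdx]
      omega
  · rw [if_neg h, dif_neg (mt (OKA_mulTranspose hA _ _).1 h)]

/-- The inclusion of the span of the `x^γ y^{μAᵀ}` into `R_A(F)`. -/
def monomialEmbed (F : Type) [Field F] (hA : (Aq A).det ≠ 0) : ((ι → ℤ) →₀ F) →ₗ[F] RMod F A :=
  Finsupp.lmapDomain F F (okIdx hA)

theorem monomialEmbed_single (hA : (Aq A).det ≠ 0) (m : ι → ℤ) (a : F) :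
    monomialEmbed F hA (Finsupp.single m a) = Finsupp.single (okIdx hA m) a := by
  simp [monomialEmbed]

theorem comp_monomialEmbed (hA : (Aq A).det ≠ 0) {f : RMod F A →ₗ[F] RMod F A}
    {g : End F ((ι → ℤ) →₀ F)}
    (h : ∀ m, f (Finsupp.single (okIdx hA m) 1) = monomialEmbed F hA (g (Finsupp.single m 1)))
    (x : (ι → ℤ) →₀ F) : f (monomialEmbed F hA x) = monomialEmbed F hA (g x) := by
  have : f ∘ₗ monomialEmbed F hA = monomialEmbed F hA ∘ₗ g := by
    refine Finsupp.basisSingleOne.ext fun m => ?_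
    rw [Finsupp.coe_basisSingleOne, LinearMap.comp_apply, monomialEmbed_single, h]
    rfl
  exact LinearMap.congr_fun this x

theorem thetaOp_monomialEmbed (hA : (Aq A).det ≠ 0) (i : ι) (x : (ι → ℤ) →₀ F) :
    thetaOp F A i (monomialEmbed F hA x) = monomialEmbed F hA (thetaZ F i x) := by
  refine comp_monomialEmbed hA (fun m => ?_) x
  rw [thetaZ, monoOp_single, add_zero, monomialEmbed_single, thetaOp,
    Finsupp.linearCombination_single]
  simp [okIdx]

theorem TdualOp_monomialEmbed (hA : (Aq A).det ≠ 0) {π ρ : F}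
    (hρ : ∀ (μ : ι → ℕ) (i : ι), π⁻¹ * Matrix.vecMul
      (fun k => (mulTranspose A μ k : F)) ((A.map ((↑) : ℕ → F))ᵀ)⁻¹ i = ρ * μ i)
    (i : ι) (x : (ι → ℤ) →₀ F) :
    TdualOp F π A i (monomialEmbed F hA x) = monomialEmbed F hA (tdualZ ρ i x) := by
  refine comp_monomialEmbed hA (fun m => ?_) x
  rw [tdualZ, monoOp_single, add_zero, monomialEmbed_single, TdualOp,
    Finsupp.linearCombination_single]
  simp [okIdx, hρ]

theorem psidualOp_monomialEmbed (hA : (Aq A).det ≠ 0) (i : ι) (x : (ι → ℤ) →₀ F) :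
    psidualOp F A i (monomialEmbed F hA x) = monomialEmbed F hA (psiZ F i x) := by
  refine comp_monomialEmbed hA (fun m => ?_) x
  rw [psiZ, monoOp_single, monomialEmbed_single, psidualOp, Finsupp.linearCombination_single,
    one_smul]
  have h : (fun j => (okIdx hA m).1.2 j + A j i) =
      mulTranspose A fun k => (-m k).toNat + if k = i then 1 else 0 := by
    funext j
    simp [okIdx, mulTranspose, add_mul, Finset.sum_add_distrib]
  rw [h, bE_mulTranspose F hA]
  have hc : (∀ j, (okIdx hA m).1.1 j = 0 ∨ ((-m j).toNat + if j = i then 1 else 0) = 0) ↔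
      m i ≤ 0 := by
    constructor
    · intro h
      have := h i
      simp only [okIdx, if_true] at this
      omega
    · intro h j
      simp only [okIdx]
      by_cases hj : j = i
      · subst hj
        omega
      · rw [if_neg hj]
        omega
  by_cases hm : m i ≤ 0
  · rw [if_pos (hc.2 hm), if_pos hm, mul_one]
    congr 2
    funext j
    simp only [okIdx, Pi.add_apply, Pi.neg_apply]
    by_cases hj : j = i
    · subst hj
      rw [if_pos rfl, Pi.single_eq_same]
      omega
    · rw [if_neg hj, Pi.single_eq_of_ne hj]
      omega
  · rw [if_neg (mt hc.1 hm), if_neg hm]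
    simp

theorem phiOp_monomialEmbed (hA : (Aq A).det ≠ 0) (π : F) (i : ι) (x : (ι → ℤ) →₀ F) :
    phiOp F π A i (monomialEmbed F hA x) = monomialEmbed F hA (phiZ π A i x) := by
  refine comp_monomialEmbed hA (fun m => ?_) x
  rw [phiOp, Finsupp.linearCombination_single, one_smul, phiZ, LinearMap.smul_apply, map_smul,
    LinearMap.sum_apply, map_sum]
  refine congrArg (π • ·) (Finset.sum_congr rfl fun l _ => ?_)
  rw [LinearMap.smul_apply, map_smul, rowZ, monoOp_single, monomialEmbed_single]
  refine congrArg ((A l i : F) • ·) ?_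
  refine (bE_mulTranspose F hA _ _).trans ?_
  have hc : (∀ j, (okIdx hA m).1.1 j + A l j = 0 ∨ (-m j).toNat = 0) ↔
      ∀ j, 0 < A l j → 0 ≤ m j := by
    refine forall_congr' fun j => ?_
    simp only [okIdx]
    omega
  by_cases hm : ∀ j, 0 < A l j → 0 ≤ m j
  · rw [if_pos (hc.2 hm), if_pos hm, mul_one]
    congr 2
    funext j
    simp only [okIdx, Pi.add_apply]
    omega
  · rw [if_neg (mt hc.1 hm), if_neg hm]
    simp

/-- The inclusion of `B^0_A(F)` into `B_A(F)`. -/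
def complexEmbed (F : Type) [Field F] (hA : (Aq A).det ≠ 0) :
    (Finset ι → (ι → ℤ) →₀ F) →ₗ[F] BMod F A :=
  (coordEquiv F A).symm ∘ₗ (monomialEmbed F hA).compLeft (Finset ι)

theorem complexEmbed_injective (hA : (Aq A).det ≠ 0) : Function.Injective (complexEmbed F hA) := by
  refine (coordEquiv F A).symm.injective.comp fun v w h => funext fun S => ?_
  exact Finsupp.mapDomain_injective (okIdx_injective hA) (congrFun h S)

theorem DOp_complexEmbed (hA : (Aq A).det ≠ 0) {π ρ : F}
    (hρ : ∀ (μ : ι → ℕ) (i : ι), π⁻¹ * Matrix.vecMul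
      (fun k => (mulTranspose A μ k : F)) ((A.map ((↑) : ℕ → F))ᵀ)⁻¹ i = ρ * μ i)
    (v : Finset ι → (ι → ℤ) →₀ F) : DOp F π A (complexEmbed F hA v) =
      complexEmbed F hA ((leadDiff π A + eulerDiff F ι ρ) v) := by
  refine (coordEquiv F A).injective ?_
  rw [coordEquiv_DOp, complexEmbed, LinearMap.comp_apply, LinearMap.comp_apply,
    LinearEquiv.coe_coe, LinearEquiv.apply_symm_apply, LinearEquiv.apply_symm_apply,
    leadDiff_add_eulerDiff]
  refine cliffordDiff_compLeft _ (fun i x => ?_) (fun i x => ?_) v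
  · rw [LinearMap.add_apply, thetaOp_monomialEmbed, phiOp_monomialEmbed, ← map_add]
    rfl
  · rw [LinearMap.add_apply, TdualOp_monomialEmbed hA hρ, psidualOp_monomialEmbed, ← map_add]
    rfl

theorem complexEmbed_monomialBasis (hA : (Aq A).det ≠ 0) (x : Σ _ : Finset ι, ι → ℤ) :
    complexEmbed F hA (monomialBasis F ι x) = basisTensor F A (okIdx hA x.2) x.1 := by
  refine (coordEquiv F A).injective ?_
  rw [complexEmbed, LinearMap.comp_apply, LinearEquiv.coe_coe, LinearEquiv.apply_symm_apply,
    monomialBasis_apply]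
  funext S
  rw [LinearMap.compLeft_apply, Function.comp_apply, basisTensor, coordEquiv_tmul]
  by_cases h : S = x.1
  · subst h
    rw [Pi.single_eq_same, Pi.single_eq_same, monomialEmbed_single, one_smul]
  · rw [Pi.single_eq_of_ne h, Pi.single_eq_of_ne h, map_zero, zero_smul]

theorem range_complexEmbed (hA : (Aq A).det ≠ 0) :
    LinearMap.range (complexEmbed F hA) = B0Sub F A := by
  rw [LinearMap.range_eq_map, ← (monomialBasis F ι).span_eq, Submodule.map_span, B0Sub, BlamSub]
  congr 1
  ext y
  constructor
  · rintro ⟨_, ⟨x, rfl⟩, rfl⟩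
    exact ⟨okIdx hA x.2, x.1, ⟨fun i => (-x.2 i).toNat, fun j => (zero_add _).symm⟩,
      complexEmbed_monomialBasis hA x⟩
  · rintro ⟨⟨⟨γ, lam⟩, hm⟩, S, ⟨μ, hμ⟩, rfl⟩
    obtain rfl : lam = mulTranspose A μ := funext fun j => by
      simpa [mulTranspose] using hμ j
    refine ⟨_, ⟨⟨S, fun i => (γ i : ℤ) - μ i⟩, rfl⟩, ?_⟩
    rw [complexEmbed_monomialBasis]
    congr 1
    refine Subtype.ext (Prod.ext ?_ (congrArg (mulTranspose A) ?_)) <;>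
    · funext i
      have := (OKA_mulTranspose hA _ _).1 hm i
      simp only [okIdx]
      omega

end Transport

section Cohomology

open Module

theorem nonempty_Hsub_equiv {F M V E : Type} [Field F] [AddCommGroup M] [Module F M]
    [AddCommGroup V] [Module F V] [AddCommGroup E] [Module F E] {D : End F M} {P : Submodule F M}
    {L : End F V} {G : V →ₗ[F] M} (hG : Function.Injective G) (hP : LinearMap.range G = P)
    (hDG : ∀ v, D (G v) = G (L v)) {t : E →ₗ[F] V} (ht : ∀ f, L (t f) = 0) {I : Submodule F E}
    (hI : ∀ f, t f ∈ LinearMap.range L ↔ f ∈ I)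
    (hker : LinearMap.ker L ≤ LinearMap.range L ⊔ LinearMap.range t) :
    Nonempty (Hsub F M D P ≃ₗ[F] (E ⧸ I)) := by
  subst hP
  set N := Submodule.comap (LinearMap.ker D ⊓ LinearMap.range G).subtype
    (Submodule.map D (LinearMap.range G)) with hN
  let s : E →ₗ[F] ↥(LinearMap.ker D ⊓ LinearMap.range G) := (G ∘ₗ t).codRestrict _ fun f =>
    ⟨LinearMap.mem_ker.2 (by rw [LinearMap.comp_apply, hDG, ht, map_zero]), ⟨t f, rfl⟩⟩
  have hmem : ∀ v, G v ∈ Submodule.map D (LinearMap.range G) ↔ v ∈ LinearMap.range L := by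
    intro v
    constructor
    · rintro ⟨_, ⟨w, rfl⟩, hw⟩
      exact ⟨w, hG (by rw [← hDG, hw])⟩
    · rintro ⟨w, rfl⟩
      exact ⟨G w, ⟨w, rfl⟩, hDG w⟩
  have hsurj : Function.Surjective (N.mkQ ∘ₗ s) := by
    intro y
    obtain ⟨⟨_, hv, v, rfl⟩, rfl⟩ := N.mkQ_surjective y
    have hv' : L v = 0 := hG (by rw [← hDG, map_zero]; exact hv)
    obtain ⟨b, hb, _, ⟨f, rfl⟩, rfl⟩ := Submodule.mem_sup.1 (hker hv')
    refine ⟨f, (Submodule.Quotient.eq N).2 ?_⟩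
    rw [hN, Submodule.mem_comap]
    have : G (t f - (b + t f)) ∈ Submodule.map D (LinearMap.range G) :=
      (hmem _).2 (by rw [sub_add_cancel_right]; exact neg_mem hb)
    rwa [map_sub] at this
  have hkerI : LinearMap.ker (N.mkQ ∘ₗ s) = I := by
    ext f
    rw [LinearMap.mem_ker, LinearMap.comp_apply, Submodule.mkQ_apply,
      Submodule.Quotient.mk_eq_zero, ← hI, ← hmem]
    rfl
  exact ⟨((Submodule.quotEquivOfEq _ _ hkerI).symm.trans
    ((N.mkQ ∘ₗ s).quotKerEquivOfSurjective hsurj)).symm⟩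

theorem RingTheory.Sequence.IsWeaklyRegular.mem_span_of_mul_mem {R : Type} [CommRing R] {n : ℕ}
    {a : Fin n → R}
    (h : RingTheory.Sequence.IsWeaklyRegular R ((Finset.univ.sort (· ≤ ·)).map a))
    (i : Fin n) {r : R} (hr : a i * r ∈ Ideal.span (a '' {j | j < i})) :
    r ∈ Ideal.span (a '' {j | j < i}) := by
  rw [Fin.sort_univ] at h
  have hi : (i : ℕ) < ((List.finRange n).map a).length := by simp
  have key := h.regular_mod_prev i hi
  have hspan : Ideal.ofList (((List.finRange n).map a).take i) • (⊤ : Submodule R R) =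
      Ideal.span (a '' {j | j < i}) := by
    rw [smul_eq_mul, Ideal.mul_top, Ideal.ofList]
    congr 1
    ext y
    simp only [List.mem_take_iff_getElem, Set.mem_ofPred_eq, Set.mem_image]
    constructor
    · rintro ⟨k, hk, rfl⟩
      simp only [List.length_map, List.length_finRange, lt_min_iff] at hk
      exact ⟨⟨k, hk.2⟩, hk.1, by simp⟩
    · rintro ⟨j, hj, rfl⟩
      exact ⟨j, by simpa using hj, by simp⟩
  rw [hspan] at key
  simp only [List.getElem_map, List.getElem_finRange, Fin.cast_mk, Fin.eta] at key
  rw [← Submodule.Quotient.mk_eq_zero]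
  refine key ?_
  change a i • _ = a i • _
  rw [smul_zero, ← Submodule.Quotient.mk_smul, Submodule.Quotient.mk_eq_zero]
  exact hr

end Cohomology

end

set_option synthInstance.maxHeartbeats 1000000 in
set_option maxHeartbeats 2000000 in
/-- Corollary 6.3(1): the total cohomology of `B^0_A(F)` is isomorphic, as an
`F`-vector space, to the Milnor ring `F[x]/(∂_1 W_A, …, ∂_n W_A)`. -/
theorem B0_cohomology_iso_milnor (F : Type) [Field F] (n : ℕ)
    (A : Matrix (Fin n) (Fin n) ℕ) (hA : IsBH F A) (π : F) (hπ : π ≠ 0) :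
    Nonempty ((Hsub F (BMod F A) (DOp F π A) (B0Sub F A)) ≃ₗ[F]
      (MvPolynomial (Fin n) F ⧸
        Ideal.span (Set.range fun i => MvPolynomial.pderiv i (Wpoly F A)))) := by
  obtain ⟨hdet, -, ⟨q, hq, hqA⟩, hreg⟩ := hA
  have hdet' : (Aq A).det ≠ 0 := hdet
  obtain ⟨ρ, hρ⟩ := exists_vecMul_inv_eq π A
  have hker := ker_leadDiff_le hπ A fun i r => hreg.toIsWeaklyRegular.mem_span_of_mul_mem i
  obtain ⟨U, hU⟩ := exists_conj_of_perturbation (monomialBasis F (Fin n))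
    (fun x => expWeight q x.2) (fun x => expWeight_nonneg (fun j => (hq j).le) x.2)
    (leadDiff π A) (eulerDiff F (Fin n) ρ) (leadDiff_sq π A) (totalDiff_sq π ρ A)
    (LinearMap.range (topForm F (Fin n)))
    (by rintro _ ⟨f, rfl⟩; exact eulerDiff_topForm ρ f) hker
    (leadDiff_basis_mem_weightSpace π A q hqA)
    (fun x => eulerDiff_basis_mem_weightSpace ρ q x)
  have hrange : LinearMap.range (complexEmbed F hdet' ∘ₗ U.toLinearMap) = B0Sub F A := by
    rw [LinearEquiv.range_comp, range_complexEmbed]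
  have hcomm : ∀ v, DOp F π A ((complexEmbed F hdet' ∘ₗ U.toLinearMap) v) =
      (complexEmbed F hdet' ∘ₗ U.toLinearMap) (leadDiff π A v) := fun v => by
    rw [LinearMap.comp_apply, LinearMap.comp_apply, LinearEquiv.coe_coe,
      DOp_complexEmbed hdet' hρ, hU]
  obtain ⟨e⟩ := nonempty_Hsub_equiv (M := BMod F A) (D := DOp F π A)
    (G := complexEmbed F hdet' ∘ₗ U.toLinearMap) ((complexEmbed_injective hdet').comp U.injective) hrange
    hcomm (leadDiff_topForm π A)
    (I := (Ideal.span (Set.range fun i =>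
      MvPolynomial.pderiv i (Wpoly F A))).restrictScalars F)
    (topForm_mem_range_leadDiff hπ A) hker
  exact ⟨e.trans (Submodule.Quotient.restrictScalarsEquiv F _)⟩
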